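/- arXiv:0912.2780 — 2 statements merged into one kernel-verified Lean document; each statement's English description precedes it below -/
import Mathlib

section
/- Let n ≥ 1 and let K ⊆ ℝⁿ be an unbounded convex body (a closed convex set with nonempty interior which is not bounded). Then the topological boundary ∂K of K is homeomorphic to ℝⁿ⁻¹ if and only if rec(K) is a proper subset of its linear span, i.e., rec(K) ≠ span_ℝ(rec(K)). -/
open scoped RealInnerProductSpace

/-- The recession cone of a set `A ⊆ ℝⁿ`. -/
def recCone {n : ℕ} (A : Set (EuclideanSpace ℝ (Fin n))) : Set (EuclideanSpace ℝ (Fin n)) :=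
  {v | ∀ x ∈ A, ∀ t : ℝ, 0 ≤ t → x + t • v ∈ A}

section NoRetraction

open MeasureTheory Metric Set Module
open scoped Topology

theorem ContinuousLinearMap.det_one_add_smul_eq_sum {E : Type*} [NormedAddCommGroup E]
    [NormedSpace ℝ E] [FiniteDimensional ℝ E] (A : E →L[ℝ] E) (s : Finset ℝ)
    (hs : finrank ℝ E < s.card) (t : ℝ) :
    (1 + t • A).det = ∑ i ∈ s, (1 + i • A).det * (Lagrange.basis s id i).eval t := by
  classical
  let b := finBasis ℝ E
  let M := LinearMap.toMatrix b b (A : E →ₗ[ℝ] E)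
  let p : Polynomial ℝ := Matrix.det ((Polynomial.X : Polynomial ℝ) • M.map Polynomial.C +
    (1 : Matrix _ _ ℝ).map Polynomial.C)
  have hp (u : ℝ) : (1 + u • A).det = p.eval u := by
    rw [ContinuousLinearMap.det, ← LinearMap.det_toMatrix b, ← Polynomial.coe_evalRingHom,
      RingHom.map_det]
    congr 1
    have : LinearMap.toMatrix b b ((1 + u • A : E →L[ℝ] E) : E →ₗ[ℝ] E) = 1 + u • M := by
      have h1 : ((1 + u • A : E →L[ℝ] E) : E →ₗ[ℝ] E) = LinearMap.id + u • (A : E →ₗ[ℝ] E) := by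
        ext; simp
      rw [h1, map_add, LinearMap.toMatrix_id, map_smul]
    rw [this]
    ext i j
    by_cases hij : i = j <;> simp [hij] <;> ring
  have hdeg : p.degree < s.card := by
    refine Polynomial.degree_le_natDegree.trans_lt ?_
    have := Polynomial.natDegree_det_X_add_C_le M 1
    rw [Fintype.card_fin] at this
    exact_mod_cast this.trans_lt hs
  have h := Lagrange.eq_interpolate (s := s) (v := id) (Set.injOn_id _) hdeg
  simp_rw [hp]
  conv_lhs => rw [h]
  simp [Lagrange.interpolate_apply, Polynomial.eval_finsetSum]

variable {E : Type*} [NormedAddCommGroup E] [InnerProductSpace ℝ E] [FiniteDimensional ℝ E]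

theorem exists_forall_integral_det_eq_volume_ball [MeasurableSpace E] [BorelSpace E] {r : E → E}
    (hr : ContDiff ℝ 1 r) (hnorm : ∀ x, ‖r x‖ = 1) (hfix : ∀ x, ‖x‖ = 1 → r x = x) :
    ∃ δ : ℝ, 0 < δ ∧ ∀ t : ℝ, 0 < t → t < δ →
      ∫ x in ball (0 : E) 1, (1 + t • (fderiv ℝ r x - 1)).det = volume.real (ball (0 : E) 1) := by
  have hDc : Continuous fun x ↦ fderiv ℝ r x - 1 :=
    (hr.continuous_fderiv one_ne_zero).sub continuous_const
  obtain ⟨C, hC⟩ := (isCompact_closedBall (0 : E) 1).exists_bound_of_continuousOn hDc.continuousOn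
  set C' := max C 1
  have hC' : 0 < C' := lt_max_of_lt_right one_pos
  obtain ⟨η, hη, hdet⟩ : ∃ η > 0, ∀ A : E →L[ℝ] E, ‖A‖ < η → 0 < (1 + A).det := by
    have hc : Continuous fun A : E →L[ℝ] E ↦ (1 + A).det :=
      ContinuousLinearMap.continuous_det.comp (continuous_const.add continuous_id)
    have h0 : 0 < (1 + (0 : E →L[ℝ] E)).det := by
      simp [ContinuousLinearMap.det, ContinuousLinearMap.one_def]
    obtain ⟨η, hη, h⟩ := Metric.eventually_nhds_iff.1 (hc.continuousAt.eventually (lt_mem_nhds h0))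
    exact ⟨η, hη, fun A hA ↦ h (by simpa using hA)⟩
  refine ⟨min 1 (min 1 η / C'), by positivity, fun t ht0 htδ ↦ ?_⟩
  have ht1 : t < 1 := htδ.trans_le (min_le_left _ _)
  have htC : t * C' < min 1 η := (lt_div_iff₀ hC').1 (htδ.trans_le (min_le_right _ _))
  set g : E → E := fun x ↦ x + t • (r x - x) with hg
  have hgd (x : E) : HasStrictFDerivAt g (1 + t • (fderiv ℝ r x - 1)) x :=
    (hasStrictFDerivAt_id x).add
      (((hr.contDiffAt.hasStrictFDerivAt one_ne_zero).sub (hasStrictFDerivAt_id x)).const_smul t)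
  have hpos (x : E) (hx : x ∈ closedBall (0 : E) 1) :
      0 < (1 + t • (fderiv ℝ r x - 1)).det := by
    refine hdet _ ?_
    rw [norm_smul, Real.norm_of_nonneg ht0.le]
    calc t * ‖fderiv ℝ r x - 1‖ ≤ t * C' := by gcongr; exact (hC x hx).trans (le_max_left _ _)
      _ < η := htC.trans_le (min_le_right _ _)
  have hLip (x : E) (hx : x ∈ closedBall (0 : E) 1) (y : E) (hy : y ∈ closedBall (0 : E) 1) :
      ‖(r y - y) - (r x - x)‖ ≤ C' * ‖y - x‖ :=
    (convex_closedBall (0 : E) 1).norm_image_sub_le_of_norm_hasFDerivWithin_le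
      (f := fun x ↦ r x - x) (f' := fun x ↦ fderiv ℝ r x - 1)
      (fun z _ ↦ (((hr.differentiable one_ne_zero z).hasFDerivAt).sub
        (hasFDerivAt_id z)).hasFDerivWithinAt)
      (fun z hz ↦ (hC z hz).trans (le_max_left _ _)) hx hy
  have hinj : InjOn g (closedBall 0 1) := by
    intro x hx y hy hxy
    by_contra hne
    have hpos : 0 < ‖y - x‖ := norm_pos_iff.2 (sub_ne_zero.2 (Ne.symm hne))
    have h1 : y - x = -(t • ((r y - y) - (r x - x))) := by
      simp only [hg] at hxy
      linear_combination (norm := module) -hxy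
    have h2 : ‖y - x‖ ≤ t * (C' * ‖y - x‖) := by
      conv_lhs => rw [h1, norm_neg, norm_smul, Real.norm_of_nonneg ht0.le]
      gcongr
      exact hLip x hx y hy
    have h3 : t * C' < 1 := htC.trans_le (min_le_left _ _)
    nlinarith
  have hmaps (x : E) (hx : x ∈ ball (0 : E) 1) : g x ∈ ball (0 : E) 1 := by
    rw [mem_ball_zero_iff] at hx ⊢
    have : g x = (1 - t) • x + t • r x := by simp only [hg]; module
    calc ‖g x‖ ≤ ‖(1 - t) • x‖ + ‖t • r x‖ := this ▸ norm_add_le _ _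
      _ = (1 - t) * ‖x‖ + t := by
        rw [norm_smul, norm_smul, hnorm, Real.norm_of_nonneg ht0.le,
          Real.norm_of_nonneg (by linarith), mul_one]
      _ < 1 := by nlinarith
  have hopen : IsOpen (g '' ball 0 1) := by
    rw [isOpen_iff_mem_nhds]
    rintro _ ⟨x, hx, rfl⟩
    have hd := (hpos x (ball_subset_closedBall hx)).ne'
    have h2 := (hgd x).map_nhds_eq_of_equiv
      (f' := ContinuousLinearMap.toContinuousLinearEquivOfDetNeZero _ hd)
    rw [← h2]
    exact Filter.image_mem_map (isOpen_ball.mem_nhds hx)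
  have himg : g '' ball 0 1 = ball 0 1 := by
    refine Subset.antisymm (image_subset_iff.2 hmaps) ?_
    have hgc : Continuous g := continuous_iff_continuousAt.2 fun x ↦ (hgd x).continuousAt
    have hcl : IsClosed (g '' closedBall 0 1) :=
      ((isCompact_closedBall (0 : E) 1).image hgc).isClosed
    refine (convex_ball (0 : E) 1).isPreconnected.subset_left_of_subset_union hopen
      hcl.isOpen_compl ?_ ?_ ⟨g 0, hmaps 0 (by simp), mem_image_of_mem _ (by simp)⟩
    · exact disjoint_compl_right_iff_subset.2 (image_mono ball_subset_closedBall)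
    · intro y hy
      by_contra hcon
      rw [mem_union, not_or, notMem_compl_iff] at hcon
      obtain ⟨hn, x, hx, rfl⟩ := hcon
      rcases (mem_closedBall_zero_iff.1 hx).lt_or_eq with h | h
      · exact hn (mem_image_of_mem _ (mem_ball_zero_iff.2 h))
      · rw [mem_ball_zero_iff] at hy
        simp [hg, hfix x h, h] at hy
  have hvol := lintegral_abs_det_fderiv_eq_addHaar_image (volume : Measure E)
    measurableSet_ball (fun x _ ↦ (hgd x).hasFDerivAt.hasFDerivWithinAt)
    (hinj.mono ball_subset_closedBall)
  rw [himg] at hvol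
  have hcont : Continuous fun x ↦ (1 + t • (fderiv ℝ r x - 1)).det :=
    ContinuousLinearMap.continuous_det.comp (continuous_const.add (hDc.const_smul t))
  rw [integral_eq_lintegral_of_nonneg_ae
    ((ae_restrict_iff' measurableSet_ball).2 (.of_forall fun x hx ↦
      (hpos x (ball_subset_closedBall hx)).le)) hcont.aestronglyMeasurable, Measure.real, ← hvol]
  congr 1
  refine setLIntegral_congr_fun measurableSet_ball fun x hx ↦ ?_
  simp only [abs_of_pos (hpos x (ball_subset_closedBall hx))]

theorem not_exists_contDiff_retraction_sphere {r : E → E}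
    (hr : ContDiff ℝ 1 r) (hnorm : ∀ x, ‖r x‖ = 1) (hfix : ∀ x, ‖x‖ = 1 → r x = x) : False := by
  borelize E
  obtain ⟨δ, hδ, h⟩ := exists_forall_integral_det_eq_volume_ball hr hnorm hfix
  obtain ⟨s, hsδ, hs⟩ := (Ioo_infinite hδ).exists_subset_card_eq (finrank ℝ E + 1)
  have hs' : finrank ℝ E < s.card := by lia
  have hne : s.Nonempty := Finset.card_pos.1 (by lia)
  have hdet (x : E) : (fderiv ℝ r x).det = 0 := by
    by_contra hd
    have h1 : HasFDerivAt (fun y ↦ ‖r y‖ ^ 2) _ x :=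
      ((hr.differentiable one_ne_zero x).hasFDerivAt).norm_sq
    simp only [hnorm] at h1
    have h2 := h1.unique (hasFDerivAt_const _ x)
    let e := ContinuousLinearMap.toContinuousLinearEquivOfDetNeZero _ hd
    have h3 : fderiv ℝ r x (e.symm (r x)) = r x := e.apply_symm_apply (r x)
    have h4 := congrArg (fun A ↦ A (e.symm (r x))) h2
    simp [h3, hnorm] at h4
  have hint (t : ℝ) : IntegrableOn (fun x ↦ (1 + t • (fderiv ℝ r x - 1)).det)
      (ball (0 : E) 1) := by
    have hcont : Continuous fun x ↦ (1 + t • (fderiv ℝ r x - 1)).det :=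
      ContinuousLinearMap.continuous_det.comp (continuous_const.add
        (((hr.continuous_fderiv one_ne_zero).sub continuous_const).const_smul t))
    exact (hcont.continuousOn.integrableOn_compact (isCompact_closedBall 0 1)).mono_set
      ball_subset_closedBall
  have key : ∫ x in ball (0 : E) 1, (1 + (1 : ℝ) • (fderiv ℝ r x - 1)).det
      = volume.real (ball (0 : E) 1) := by
    simp_rw [fun x ↦ (fderiv ℝ r x - 1).det_one_add_smul_eq_sum s hs' 1]
    rw [integral_finsetSum _ fun i _ ↦ (hint i).mul_const _]
    simp_rw [integral_mul_const]
    rw [Finset.sum_congr rfl fun i hi ↦ by rw [h i (hsδ hi).1 (hsδ hi).2], ← Finset.mul_sum,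
      ← Polynomial.eval_finsetSum, Lagrange.sum_basis (injOn_id _) hne]
    simp
  simp [hdet] at key
  exact (ENNReal.toReal_pos (measure_ball_pos _ _ one_pos).ne' measure_ball_lt_top.ne).ne key

theorem not_exists_continuous_retraction_sphere {r : E → E}
    (hr : Continuous r) (hnorm : ∀ x, ‖r x‖ = 1) (hfix : ∀ x, ‖x‖ = 1 → r x = x) : False := by
  let f : E → E := fun x ↦ if ‖x‖ ≤ 1 then r x - x else 0
  have hf : Continuous f :=
    Continuous.if_le (by fun_prop) continuous_const continuous_norm continuous_const
      fun x hx ↦ by simp [hfix x hx]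
  obtain ⟨g, hgd, hgf, hgs⟩ := hf.exists_contDiff_approx 1 (ε := fun _ ↦ 1) continuous_const
    fun _ ↦ one_pos
  have hg (x : E) (hx : ‖x‖ = 1) : g x = 0 := by
    by_contra h
    exact hgs h (by simp [f, hx, hfix x hx])
  have hne (x : E) : x + g x ≠ 0 := by
    intro h
    have h1 := hgf x
    rw [eq_neg_of_add_eq_zero_right h, dist_eq_norm] at h1
    by_cases hx : ‖x‖ ≤ 1
    · have h2 : -x - (r x - x) = -r x := by abel
      simp [f, hx, h2, hnorm] at h1
    · simp only [f, hx, if_false, sub_zero, norm_neg] at h1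
      exact hx h1.le
  refine not_exists_contDiff_retraction_sphere (r := fun x ↦ ‖x + g x‖⁻¹ • (x + g x)) ?_ ?_ ?_
  · have h1 : ContDiff ℝ 1 fun x ↦ x + g x := contDiff_id.add hgd
    exact ((h1.norm ℝ hne).inv fun x ↦ norm_ne_zero_iff.2 (hne x)).smul h1
  · intro x
    rw [norm_smul, norm_inv, norm_norm, inv_mul_cancel₀ (norm_ne_zero_iff.2 (hne x))]
  · intro x hx
    simp [hg x hx, hx]

end NoRetraction

section StarConvex

open Set Metric
open scoped Topology

variable {E : Type*} [NormedAddCommGroup E] [NormedSpace ℝ E]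

/-- A positive continuous function that is at most `1` and nonincreasing along rays from the origin
has a unique fixed scale on every ray, and that scale varies continuously. -/
theorem exists_continuous_scale {m : E → ℝ} (hm : Continuous m) (h0 : 0 < m 0)
    (h1 : ∀ x, m x ≤ 1) (hanti : ∀ x, ∀ t : ℝ, 0 ≤ t → t ≤ 1 → m x ≤ m (t • x)) :
    ∃ s : E → ℝ, Continuous s ∧ (∀ y, 0 < s y) ∧ (∀ y, m (s y • y) = s y) ∧
      ∀ y, ∀ a : ℝ, 0 < a → m (a • y) = a → a = s y := by
  have hmono (y : E) {a b : ℝ} (ha : 0 ≤ a) (hab : a ≤ b) : m (b • y) ≤ m (a • y) := by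
    rcases (ha.trans hab).eq_or_lt with hb | hb
    · rw [show a = b by linarith]
    · have := hanti (b • y) (a / b) (by positivity) ((div_le_one hb).2 hab)
      rwa [smul_smul, div_mul_cancel₀ _ hb.ne'] at this
  have hex (y : E) : ∃ a : ℝ, 0 < a ∧ m (a • y) = a := by
    have hc : ContinuousOn (fun a : ℝ ↦ a - m (a • y)) (Icc 0 1) := by fun_prop
    obtain ⟨a, ha, hay⟩ := intermediate_value_Icc zero_le_one hc
      (show (0 : ℝ) ∈ _ from ⟨by simpa using h0.le, by simpa using h1 y⟩)
    replace hay : a - m (a • y) = 0 := hay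
    refine ⟨a, ha.1.lt_of_ne ?_, by linarith⟩
    rintro rfl
    simp only [zero_smul] at hay
    linarith
  choose s hs0 hs using hex
  refine ⟨s, ?_, hs0, hs, fun y a ha hay ↦ ?_⟩
  · refine continuous_iff_continuousAt.2 fun y ↦ Metric.tendsto_nhds.2 fun ε hε ↦ ?_
    have hu : s y + ε > m ((s y + ε) • y) := by
      have := hmono y (hs0 y).le (show s y ≤ s y + ε by linarith)
      linarith [hs y]
    have hl : max 0 (s y - ε) < m (max 0 (s y - ε) • y) := by
      have := hmono y (le_max_left 0 (s y - ε)) (max_le (hs0 y).le (by linarith))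
      rw [hs y] at this
      exact (max_lt (hs0 y) (by linarith)).trans_le this
    have hc (a : ℝ) : ContinuousAt (fun z ↦ m (a • z)) y := by fun_prop
    filter_upwards [(hc _).eventually (gt_mem_nhds hu), (hc _).eventually (lt_mem_nhds hl)]
      with z hz1 hz2
    rw [Real.dist_eq, abs_lt]
    constructor
    · by_contra hcon
      have := hmono z (hs0 z).le ((show s z ≤ s y - ε by linarith).trans (le_max_right 0 _))
      rw [hs z] at this
      linarith [le_max_right 0 (s y - ε)]
    · by_contra hcon
      have := hmono z (by linarith [hs0 y]) (show s y + ε ≤ s z by linarith)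
      rw [hs z] at this
      linarith
  · rcases le_total a (s y) with h | h
    · have := hmono y ha.le h
      rw [hay, hs] at this
      exact le_antisymm h this
    · have := hmono y (hs0 y).le h
      rw [hay, hs] at this
      exact le_antisymm this h

/-- A proper open star-shaped subset is the positivity set of a continuous function that is at most
`1` and nonincreasing along rays from the origin. -/
theorem IsOpen.exists_continuous_pos_iff_of_starConvex {U : Set E} (hU : IsOpen U)
    (hstar : StarConvex ℝ 0 U) (hne : Uᶜ.Nonempty) :
    ∃ m : E → ℝ, Continuous m ∧ (∀ x, m x ≤ 1) ∧ (∀ x, 0 < m x ↔ x ∈ U) ∧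
      ∀ x, ∀ t : ℝ, 0 ≤ t → t ≤ 1 → m x ≤ m (t • x) := by
  let d : E → ℝ := fun x ↦ min 1 (infDist x Uᶜ)
  have hd : Continuous d := continuous_const.min (continuous_infDist_pt _)
  have hdU (x : E) : 0 < d x ↔ x ∈ U := by
    rw [lt_min_iff, ← hU.isClosed_compl.notMem_iff_infDist_pos hne, notMem_compl_iff]
    simp
  have hd0 (x : E) : 0 ≤ d x := le_min zero_le_one infDist_nonneg
  let m : E → ℝ := fun x ↦ sInf ((fun t : ℝ ↦ d (t • x)) '' Icc 0 1)
  have hm : Continuous m := isCompact_Icc.continuous_sInf (f := fun x (t : ℝ) ↦ d (t • x))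
    (hd.comp (continuous_snd.smul continuous_fst))
  have hbdd (x : E) : BddBelow ((fun t : ℝ ↦ d (t • x)) '' Icc 0 1) :=
    ⟨0, by rintro _ ⟨t, -, rfl⟩; exact hd0 _⟩
  have hmd (x : E) : m x ≤ d x := csInf_le (hbdd x) ⟨1, by simp⟩
  have hmU (x : E) : 0 < m x ↔ x ∈ U := by
    refine ⟨fun h ↦ (hdU x).1 (h.trans_le (hmd x)), fun h ↦ ?_⟩
    obtain ⟨t, ht, hmt⟩ := (isCompact_Icc (a := (0 : ℝ)) (b := 1)).exists_sInf_image_eq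
      (nonempty_Icc.2 zero_le_one) (f := fun t : ℝ ↦ d (t • x)) (by fun_prop)
    rw [show m x = d (t • x) from hmt, hdU]
    exact starConvex_zero_iff.1 hstar h ht.1 ht.2
  have hanti (x : E) (t : ℝ) (ht0 : 0 ≤ t) (ht1 : t ≤ 1) : m x ≤ m (t • x) := by
    refine csInf_le_csInf (hbdd x) ((nonempty_Icc.2 zero_le_one).image _) ?_
    rintro _ ⟨a, ha, rfl⟩
    exact ⟨a * t, ⟨mul_nonneg ha.1 ht0, mul_le_one₀ ha.2 ht0 ht1⟩, by simp [smul_smul]⟩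
  exact ⟨m, hm, fun x ↦ (hmd x).trans (min_le_left _ _), hmU, hanti⟩

/-- An open set that is star-shaped about the origin is homeomorphic to the whole space. -/
theorem IsOpen.nonempty_homeomorph_of_starConvex {U : Set E} (hU : IsOpen U)
    (hstar : StarConvex ℝ 0 U) (h0 : (0 : E) ∈ U) : Nonempty (U ≃ₜ E) := by
  rcases eq_or_ne U univ with rfl | hne
  · exact ⟨Homeomorph.Set.univ E⟩
  obtain ⟨m, hm, hm1, hmU, hanti⟩ :=
    hU.exists_continuous_pos_iff_of_starConvex hstar (nonempty_compl.2 hne)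
  obtain ⟨s, hs, hs0, hms, huniq⟩ := exists_continuous_scale hm ((hmU 0).2 h0) hm1 hanti
  exact ⟨{
    toFun := fun x ↦ (m x)⁻¹ • (x : E)
    invFun := fun y ↦ ⟨s y • y, (hmU _).1 (by rw [hms]; exact hs0 y)⟩
    left_inv := fun x ↦ by
      have hx := (hmU x).2 x.2
      have : m x = s ((m x)⁻¹ • (x : E)) := huniq _ _ hx (by rw [smul_inv_smul₀ hx.ne'])
      ext1
      simp only [← this, smul_inv_smul₀ hx.ne']
    right_inv := fun y ↦ by
      simp only [hms, inv_smul_smul₀ (hs0 y).ne']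
    continuous_toFun := ((hm.comp continuous_subtype_val).inv₀
      fun x : U ↦ ((hmU x).2 x.2).ne').smul continuous_subtype_val
    continuous_invFun := (hs.smul continuous_id).subtype_mk _ }⟩

end StarConvex

section ConvexFrontier

open Set Metric
open scoped Topology

variable {E : Type*} [NormedAddCommGroup E] [InnerProductSpace ℝ E] {K : Set E}

/-- Stereographic projection identifies the frontier of a convex neighbourhood of the origin that
contains the ray spanned by `u` with the set of directions not contained in `K`. -/
noncomputable def Convex.frontierHomeomorphStereo (hK : Convex ℝ K) (hK0 : K ∈ 𝓝 0) {u : E}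
    (hu : ‖u‖ = 1) (hgu : gauge K u = 0) :
    frontier K ≃ₜ {w : (ℝ ∙ u)ᗮ | 0 < gauge K (stereoInvFun hu w : E)} :=
  have hg (x : frontier K) : gauge K (x : E) = 1 := (gauge_eq_one_iff_mem_frontier hK hK0).2 x.2
  have hx0 (x : frontier K) : ‖(x : E)‖ ≠ 0 := fun h ↦ by
    simpa [norm_eq_zero.1 h] using hg x
  have hgn (x : frontier K) : gauge K (‖(x : E)‖⁻¹ • (x : E)) = ‖(x : E)‖⁻¹ := by
    rw [gauge_smul_of_nonneg (by positivity), hg, smul_eq_mul, mul_one]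
  have hnn (x : frontier K) : ‖‖(x : E)‖⁻¹ • (x : E)‖ = 1 := by
    rw [norm_smul, norm_inv, norm_norm, inv_mul_cancel₀ (hx0 x)]
  have hne (x : frontier K) : ‖(x : E)‖⁻¹ • (x : E) ≠ u := fun h ↦ by
    have := hgn x
    rw [h, hgu] at this
    exact hx0 x (inv_eq_zero.1 this.symm)
  have hleft (x : frontier K) : (stereoInvFun hu (stereoToFun u (‖(x : E)‖⁻¹ • (x : E))) : E) =
      ‖(x : E)‖⁻¹ • (x : E) :=
    congrArg Subtype.val (stereo_left_inv hu
      (x := ⟨‖(x : E)‖⁻¹ • (x : E), mem_sphere_zero_iff_norm.2 (hnn x)⟩) (hne x))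
  { toFun := fun x ↦ ⟨stereoToFun u (‖(x : E)‖⁻¹ • (x : E)), by
      rw [mem_ofPred_eq, hleft, hgn]
      exact inv_pos.2 ((norm_nonneg _).lt_of_ne' (hx0 x))⟩
    invFun := fun w ↦ ⟨(gauge K (stereoInvFun hu w : E))⁻¹ • (stereoInvFun hu w : E), by
      rw [← gauge_eq_one_iff_mem_frontier hK hK0,
        gauge_smul_of_nonneg (inv_nonneg.2 (gauge_nonneg _)), smul_eq_mul]
      exact inv_mul_cancel₀ w.2.out.ne'⟩
    left_inv := fun x ↦ by
      ext1
      simp only [hleft, hgn]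
      rw [inv_inv, smul_inv_smul₀ (hx0 x)]
    right_inv := fun w ↦ by
      have hw : 0 < gauge K (stereoInvFun hu w : E) := w.2
      have hn : ‖(stereoInvFun hu w : E)‖ = 1 := norm_eq_of_mem_sphere _
      ext1
      simp only
      rw [norm_smul, hn, mul_one, norm_inv, inv_inv, Real.norm_of_nonneg hw.le,
        smul_inv_smul₀ hw.ne', stereo_right_inv]
    continuous_toFun := by
      refine Continuous.subtype_mk (continuousOn_stereoToFun.comp_continuous
        ((continuous_subtype_val.norm.inv₀ hx0).smul continuous_subtype_val) fun x h ↦ ?_) _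
      exact hne x ((inner_eq_one_iff_of_norm_eq_one hu (hnn x)).1 h).symm
    continuous_invFun := by
      have hc : Continuous fun w : {w : (ℝ ∙ u)ᗮ | 0 < gauge K (stereoInvFun hu w : E)} ↦
          (stereoInvFun hu w : E) :=
        continuous_subtype_val.comp ((continuous_stereoInvFun hu).comp continuous_subtype_val)
      exact ((((continuous_gauge hK hK0).comp hc).inv₀ fun w ↦ w.2.out.ne').smul hc).subtype_mk _ }

theorem Convex.starConvex_setOf_gauge_stereoInvFun_pos (hK : Convex ℝ K) (hK0 : K ∈ 𝓝 0) {u : E}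
    (hu : ‖u‖ = 1) (hgu : gauge K u = 0) (hgnu : gauge K (-u) ≠ 0) :
    StarConvex ℝ 0 {w : (ℝ ∙ u)ᗮ | 0 < gauge K (stereoInvFun hu w : E)} := by
  have hiff (w : (ℝ ∙ u)ᗮ) : 0 < gauge K (stereoInvFun hu w : E) ↔
      gauge K ((4 : ℝ) • (w : E) + (‖w‖ ^ 2 - 4) • u) ≠ 0 := by
    rw [stereoInvFun_apply, gauge_smul_of_nonneg (by positivity), smul_eq_mul,
      mul_pos_iff_of_pos_left (by positivity), (gauge_nonneg _).lt_iff_ne']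
  rw [starConvex_zero_iff]
  intro w hw a ha0 ha1
  rw [mem_ofPred_eq, hiff] at hw ⊢
  intro h
  rcases ha0.eq_or_lt with rfl | ha
  · refine hgnu ?_
    rw [show (4 : ℝ) • (((0 : ℝ) • w : (ℝ ∙ u)ᗮ) : E) + (‖(0 : ℝ) • w‖ ^ 2 - 4) • u =
      (4 : ℝ) • (-u) by simp, gauge_smul_of_nonneg (by norm_num)] at h
    simpa using h
  · have hc : 0 ≤ (1 - a) * (a * ‖w‖ ^ 2 + 4) := mul_nonneg (by linarith) (by positivity)
    have heq : a • ((4 : ℝ) • (w : E) + (‖w‖ ^ 2 - 4) • u) =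
        ((4 : ℝ) • ((a • w : (ℝ ∙ u)ᗮ) : E) + (‖a • w‖ ^ 2 - 4) • u) +
          ((1 - a) * (a * ‖w‖ ^ 2 + 4)) • u := by
      rw [norm_smul, Real.norm_of_nonneg ha0, Submodule.coe_smul]
      module
    have hle := gauge_add_le hK (absorbent_nhds_zero hK0)
      ((4 : ℝ) • ((a • w : (ℝ ∙ u)ᗮ) : E) + (‖a • w‖ ^ 2 - 4) • u)
      (((1 - a) * (a * ‖w‖ ^ 2 + 4)) • u)
    rw [← heq, h, gauge_smul_of_nonneg hc, hgu, smul_zero, add_zero,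
      gauge_smul_of_nonneg ha0, smul_eq_mul] at hle
    have : 0 < gauge K ((4 : ℝ) • (w : E) + (‖w‖ ^ 2 - 4) • u) :=
      (gauge_nonneg _).lt_of_ne' hw
    nlinarith

theorem Convex.nonempty_frontier_homeomorph (hK : Convex ℝ K) (hK0 : K ∈ 𝓝 0) {u : E}
    (hu : ‖u‖ = 1) (hgu : gauge K u = 0) (hgnu : gauge K (-u) ≠ 0) :
    Nonempty (frontier K ≃ₜ (ℝ ∙ u)ᗮ) := by
  have hopen : IsOpen {w : (ℝ ∙ u)ᗮ | 0 < gauge K (stereoInvFun hu w : E)} :=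
    isOpen_lt continuous_const ((continuous_gauge hK hK0).comp
      (continuous_subtype_val.comp (continuous_stereoInvFun hu)))
  have h0 : (0 : (ℝ ∙ u)ᗮ) ∈ {w : (ℝ ∙ u)ᗮ | 0 < gauge K (stereoInvFun hu w : E)} := by
    have : (stereoInvFun hu 0 : E) = -u := by
      rw [stereoInvFun_apply]
      simp
    rw [mem_ofPred_eq, this]
    exact (gauge_nonneg _).lt_of_ne' hgnu
  exact (hopen.nonempty_homeomorph_of_starConvex
    (hK.starConvex_setOf_gauge_stereoInvFun_pos hK0 hu hgu hgnu) h0).map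
      (hK.frontierHomeomorphStereo hK0 hu hgu).trans

/-- If the gauge of a convex neighbourhood of the origin vanishes exactly on a linear subspace, then
the frontier is not homeomorphic to a finite-dimensional vector space. -/
theorem Convex.isEmpty_frontier_homeomorph [FiniteDimensional ℝ E] (hK : Convex ℝ K)
    (hK0 : K ∈ 𝓝 0) (L : Submodule ℝ E) (hL : ∀ x, gauge K x = 0 ↔ x ∈ L) (F : Type*)
    [NormedAddCommGroup F] [NormedSpace ℝ F] [FiniteDimensional ℝ F] :
    IsEmpty (frontier K ≃ₜ F) := by
  refine ⟨fun φ ↦ ?_⟩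
  let P : frontier K → Lᗮ := fun x ↦ Lᗮ.orthogonalProjectionOnto (x : E)
  have hP (x : frontier K) : ‖P x‖ ≠ 0 := fun h ↦ by
    have h1 := norm_eq_zero.1 h
    rw [Submodule.orthogonalProjectionOnto_eq_zero_iff, Submodule.orthogonal_orthogonal,
      ← hL, (gauge_eq_one_iff_mem_frontier hK hK0).2 x.2] at h1
    exact one_ne_zero h1
  have hPc : Continuous P := Lᗮ.orthogonalProjectionOnto.continuous.comp continuous_subtype_val
  let q : frontier K → Lᗮ := fun x ↦ ‖P x‖⁻¹ • P x
  have hq : Continuous q := (hPc.norm.inv₀ hP).smul hPc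
  have hgpos (w : sphere (0 : Lᗮ) 1) : 0 < gauge K (w : E) := by
    refine (gauge_nonneg _).lt_of_ne' fun h ↦ ?_
    have h1 : (w : Lᗮ) = 0 := Subtype.ext (Submodule.disjoint_def.1 L.orthogonal_disjoint _ ((hL _).1 h) w.1.2)
    have h2 := norm_eq_of_mem_sphere w
    simp [h1] at h2
  let i : C(sphere (0 : Lᗮ) 1, frontier K) :=
    ⟨fun w ↦ ⟨(gauge K (w : E))⁻¹ • (w : E), by
      rw [← gauge_eq_one_iff_mem_frontier hK hK0,
        gauge_smul_of_nonneg (inv_nonneg.2 (gauge_nonneg _)), smul_eq_mul]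
      exact inv_mul_cancel₀ (hgpos w).ne'⟩, by
      have hc : Continuous fun w : sphere (0 : Lᗮ) 1 ↦ (w : E) :=
        continuous_subtype_val.comp continuous_subtype_val
      exact ((((continuous_gauge hK hK0).comp hc).inv₀
        fun w ↦ (hgpos w).ne').smul hc).subtype_mk _⟩
  obtain ⟨G, hG⟩ := ((φ : C(frontier K, F)).comp i).exists_restrict_eq isClosed_sphere
  refine not_exists_continuous_retraction_sphere (r := fun x ↦ q (φ.symm (G x)))
    (hq.comp (φ.symm.continuous.comp G.continuous)) (fun x ↦ ?_) fun x hx ↦ ?_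
  · simp only [q]
    rw [norm_smul, norm_inv, norm_norm, inv_mul_cancel₀ (hP _)]
  · have h1 : G x = φ (i ⟨x, mem_sphere_zero_iff_norm.2 hx⟩) :=
      DFunLike.congr_fun hG ⟨x, mem_sphere_zero_iff_norm.2 hx⟩
    have hpos : 0 < gauge K (x : E) := hgpos ⟨x, mem_sphere_zero_iff_norm.2 hx⟩
    have h2 : P (i ⟨x, mem_sphere_zero_iff_norm.2 hx⟩) = (gauge K (x : E))⁻¹ • x := by
      simp [P, i]
    simp only [h1, Homeomorph.symm_apply_apply, q, h2]
    rw [norm_smul, hx, mul_one, norm_inv, inv_inv, Real.norm_of_nonneg hpos.le,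
      smul_inv_smul₀ hpos.ne']

end ConvexFrontier

section RecessionCone

open Set
open scoped Topology

variable {n : ℕ} {K : Set (EuclideanSpace ℝ (Fin n))}

theorem mem_recCone_iff_gauge_eq_zero (hKcl : IsClosed K) (hKconv : Convex ℝ K)
    {p : EuclideanSpace ℝ (Fin n)} (hp : p ∈ interior K) (v : EuclideanSpace ℝ (Fin n)) :
    v ∈ recCone K ↔ gauge ((p + ·) ⁻¹' K) v = 0 := by
  have hconv : Convex ℝ ((p + ·) ⁻¹' K) := hKconv.translate_preimage_right p
  have hnhds : (p + ·) ⁻¹' K ∈ 𝓝 0 :=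
    (continuous_const_add p).continuousAt.preimage_mem_nhds
      (by simpa using mem_interior_iff_mem_nhds.1 hp)
  constructor
  · intro hv
    refine le_antisymm (le_of_forall_gt_imp_ge_of_dense fun ε hε ↦ ?_) (gauge_nonneg _)
    refine gauge_le_of_mem hε.le ?_
    rw [mem_smul_set_iff_inv_smul_mem₀ hε.ne']
    exact hv p (interior_subset hp) ε⁻¹ (inv_nonneg.2 hε.le)
  · intro hv x hx t ht
    have hray (a : ℝ) (ha : 0 ≤ a) : p + a • v ∈ K := by
      have : gauge ((p + ·) ⁻¹' K) (a • v) ≤ 1 := by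
        rw [gauge_smul_of_nonneg ha, hv, smul_zero]
        exact zero_le_one
      rw [gauge_le_one_iff_mem_closure hconv hnhds,
        (hKcl.preimage (continuous_const_add p)).closure_eq] at this
      exact this
    have hlim : Filter.Tendsto (fun a : ℝ ↦ (1 - a) • x + (a • p + t • v)) (𝓝[>] 0)
        (𝓝 (x + t • v)) := by
      have : Continuous fun a : ℝ ↦ (1 - a) • x + (a • p + t • v) := by fun_prop
      simpa using (this.tendsto 0).mono_left nhdsWithin_le_nhds
    refine hKcl.mem_of_tendsto hlim ?_
    filter_upwards [Ioo_mem_nhdsGT (zero_lt_one' ℝ)] with a ha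
    have := hKconv hx (hray (a⁻¹ * t) (mul_nonneg (inv_nonneg.2 ha.1.le) ht))
      (sub_nonneg.2 ha.2.le) ha.1.le (by ring)
    rwa [smul_add, smul_smul, mul_inv_cancel_left₀ ha.1.ne'] at this

theorem recCone_eq_span_of_neg_mem (h : ∀ v ∈ recCone K, -v ∈ recCone K) :
    recCone K = (Submodule.span ℝ (recCone K) : Set (EuclideanSpace ℝ (Fin n))) := by
  have hsmul (c : ℝ) (hc : 0 ≤ c) (v) (hv : v ∈ recCone K) : c • v ∈ recCone K :=
    fun x hx t ht ↦ by simpa [smul_smul] using hv x hx (t * c) (mul_nonneg ht hc)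
  let L : Submodule ℝ (EuclideanSpace ℝ (Fin n)) :=
    { carrier := recCone K
      zero_mem' := fun x hx t _ ↦ by simpa using hx
      add_mem' := fun {v w} hv hw x hx t ht ↦ by
        simpa [add_assoc] using hw _ (hv x hx t ht) t ht
      smul_mem' := fun c v hv ↦ by
        rcases le_total 0 c with hc | hc
        · exact hsmul c hc v hv
        · simpa using hsmul (-c) (neg_nonneg.2 hc) (-v) (h v hv) }
  exact congrArg SetLike.coe (Submodule.span_eq L).symm

end RecessionCone

/-- For an unbounded convex body `K ⊆ ℝⁿ`, the boundary `∂K` is homeomorphic to `ℝⁿ⁻¹`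
if and only if the recession cone of `K` is a proper subset of its linear span. -/
theorem boundary_homeo_euclidean_iff_recCone_relatively_proper (n : ℕ) (hn : 1 ≤ n)
    (K : Set (EuclideanSpace ℝ (Fin n)))
    (hKcl : IsClosed K) (hKconv : Convex ℝ K) (hKint : (interior K).Nonempty)
    (hKunb : ¬ Bornology.IsBounded K) :
    Nonempty ((frontier K) ≃ₜ EuclideanSpace ℝ (Fin (n - 1))) ↔
      recCone K ≠ (Submodule.span ℝ (recCone K) : Set (EuclideanSpace ℝ (Fin n))) := by
  obtain ⟨p, hp⟩ := hKint
  have hrec := mem_recCone_iff_gauge_eq_zero hKcl hKconv hp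
  set K₀ := (p + ·) ⁻¹' K
  have hconv : Convex ℝ K₀ := hKconv.translate_preimage_right p
  have hnhds : K₀ ∈ nhds 0 := (continuous_const_add p).continuousAt.preimage_mem_nhds
    (by simpa using mem_interior_iff_mem_nhds.1 hp)
  have e : frontier K₀ ≃ₜ frontier K :=
    ((Homeomorph.addLeft p).image (frontier K₀)).trans <| Homeomorph.setCongr <| by
      rw [Homeomorph.image_frontier]
      exact congrArg frontier (Set.image_preimage_eq K (Homeomorph.addLeft p).surjective)
  constructor
  · rintro ⟨φ⟩ hspan
    refine (hconv.isEmpty_frontier_homeomorph hnhds (Submodule.span ℝ (recCone K))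
      (fun x ↦ ?_) _).false (e.trans φ)
    rw [← hrec, ← SetLike.mem_coe, ← hspan]
  · intro hspan
    obtain ⟨v, hv, hnv⟩ : ∃ v ∈ recCone K, -v ∉ recCone K := by
      by_contra! h
      exact hspan (recCone_eq_span_of_neg_mem h)
    rw [hrec] at hv hnv
    have hv0 : v ≠ 0 := by
      rintro rfl
      simp at hnv
    have hu : ‖‖v‖⁻¹ • v‖ = 1 := norm_smul_inv_norm hv0
    obtain ⟨ψ⟩ := hconv.nonempty_frontier_homeomorph hnhds hu
      (by rw [gauge_smul_of_nonneg (by positivity), hv, smul_zero])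
      (by
        rw [← smul_neg, gauge_smul_of_nonneg (by positivity)]
        exact mul_ne_zero (inv_ne_zero (norm_ne_zero_iff.2 hv0)) hnv)
    obtain ⟨k, rfl⟩ := Nat.exists_eq_add_of_le' hn
    have : Fact (Module.finrank ℝ (EuclideanSpace ℝ (Fin (k + 1))) = k + 1) := ⟨by simp⟩
    have hfin : Module.finrank ℝ (ℝ ∙ (‖v‖⁻¹ • v))ᗮ =
        Module.finrank ℝ (EuclideanSpace ℝ (Fin (k + 1 - 1))) := by
      rw [Submodule.finrank_orthogonal_span_singleton (n := k) (norm_ne_zero_iff.1 (by simp [hu]))]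
      simp
    exact ⟨(e.symm.trans ψ).trans (ContinuousLinearEquiv.ofFinrankEq hfin).toHomeomorph⟩
end

section
/- Let n ≥ 1 and let K ⊆ ℝⁿ be an unbounded convex body whose boundary ∂K is homeomorphic to ℝⁿ⁻¹. Let m := dim span_ℝ(rec(K)) and v := ∫_{rec(K) ∩ S^{n-1}} x dμH^{m-1}(x). Then v ≠ 0, and the central direction u := v/‖v‖ of K is a balanced direction of K; that is: (i) u ∈ rec(K); (ii) there exists p ∈ K with ⟨p,u⟩ ≤ ⟨x,u⟩ for all x ∈ K; and (iii) for the face F := {x ∈ K : ⟨x,u⟩ = ⟨p,u⟩}, every half-line contained in F extends to a whole line in F: for every x ∈ F and v₀ ≠ 0, if x + t·v₀ ∈ F for all t ≥ 0 then x + t·v₀ ∈ F for all t ∈ ℝ. -/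
open scoped RealInnerProductSpace
open MeasureTheory

section NoRetraction

open Set Metric
open scoped NNReal

/-- Evaluation at `1` of real polynomials of bounded degree is a fixed linear combination of
evaluations at points of a prescribed interval `(0, δ]`. -/
lemma exists_eval_one_eq_sum_eval (d : ℕ) {δ : ℝ} (hδ : 0 < δ) :
    ∃ s c : ℕ → ℝ, (∀ i, 0 < s i ∧ s i ≤ δ) ∧ ∀ P : Polynomial ℝ, P.natDegree ≤ d →
      P.eval 1 = ∑ i ∈ Finset.range (d + 1), c i * P.eval (s i) := by
  have hinj : Set.InjOn (fun i : ℕ => δ / ((i : ℝ) + 1)) (Finset.range (d + 1)) := by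
    intro i _ j _ hij
    have hi : (i : ℝ) + 1 ≠ 0 := by positivity
    have hj : (j : ℝ) + 1 ≠ 0 := by positivity
    have hij' : δ / ((i : ℝ) + 1) = δ / ((j : ℝ) + 1) := hij
    rw [div_eq_div_iff hi hj] at hij'
    have := mul_left_cancel₀ hδ.ne' hij'
    exact_mod_cast (by linarith : (i : ℝ) = j)
  refine ⟨fun i => δ / ((i : ℝ) + 1),
    fun i => (Lagrange.basis (Finset.range (d + 1)) (fun i : ℕ => δ / ((i : ℝ) + 1)) i).eval 1,
    fun i => ⟨by positivity, div_le_self hδ.le (by linarith [(Nat.cast_nonneg i : (0 : ℝ) ≤ i)])⟩,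
    fun P hP => ?_⟩
  have hdeg : P.degree < (Finset.range (d + 1)).card := by
    rw [Finset.card_range]
    exact lt_of_le_of_lt Polynomial.degree_le_natDegree (by exact_mod_cast Nat.lt_succ_of_le hP)
  conv_lhs => rw [Lagrange.eq_interpolate hinj hdeg, Lagrange.interpolate_apply,
    Polynomial.eval_finsetSum]
  simp [mul_comm]

variable {E : Type*} [NormedAddCommGroup E] [InnerProductSpace ℝ E]

/-- Extending by zero outside a ball preserves Lipschitz constants. -/
lemma LipschitzOnWith.indicator_closedBall {f : E → E} {r : ℝ} {L : ℝ≥0}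
    (hf : LipschitzOnWith L f (closedBall 0 r)) (h0 : ∀ x, ‖x‖ = r → f x = 0) :
    LipschitzWith L ((closedBall 0 r).indicator f) := by
  have key : ∀ x ∈ closedBall (0 : E) r, ∀ y ∉ closedBall (0 : E) r,
      dist (f x) 0 ≤ L * dist x y := by
    intro x hx y hy
    rw [mem_closedBall_zero_iff] at hx hy
    obtain ⟨z, hz, hzr⟩ := (convex_segment x y).isPreconnected.intermediate_value
      (left_mem_segment ℝ x y) (right_mem_segment ℝ x y) continuous_norm.continuousOn
      ⟨hx, (not_le.1 hy).le⟩
    have h1 := hf.dist_le_mul x (by simpa using hx) z (by simp [hzr])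
    rw [h0 z hzr] at h1
    have h2 := dist_add_dist_of_mem_segment hz
    refine h1.trans (mul_le_mul_of_nonneg_left ?_ L.2)
    linarith [dist_nonneg (x := z) (y := y)]
  refine LipschitzWith.of_dist_le_mul fun x y => ?_
  by_cases hx : x ∈ closedBall (0 : E) r <;> by_cases hy : y ∈ closedBall (0 : E) r
  · simpa [hx, hy] using hf.dist_le_mul x hx y hy
  · rw [indicator_of_mem hx, indicator_of_notMem hy]
    exact key x hx y hy
  · rw [indicator_of_notMem hx, indicator_of_mem hy, dist_comm, dist_comm x]
    exact key y hy x hx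
  · rw [indicator_of_notMem hx, indicator_of_notMem hy, dist_self]
    positivity

variable [FiniteDimensional ℝ E]

/-- The determinant of `1 + t A` is polynomial in `t`. -/
lemma exists_polynomial_eval_eq_det_one_add_smul (A : E →L[ℝ] E) :
    ∃ P : Polynomial ℝ, P.natDegree ≤ Module.finrank ℝ E ∧
      ∀ t : ℝ, P.eval t = (1 + t • A : E →L[ℝ] E).det := by
  classical
  let b := Module.finBasis ℝ E
  let M := LinearMap.toMatrix b b (A : E →ₗ[ℝ] E)
  refine ⟨_, (Polynomial.natDegree_det_X_add_C_le M 1).trans_eq (Fintype.card_fin _), fun t => ?_⟩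
  rw [ContinuousLinearMap.det, ← LinearMap.det_toMatrix b, ← Polynomial.coe_evalRingHom,
    RingHom.map_det]
  congr 1
  ext i j
  by_cases hij : i = j
  · subst hij
    simp [M, LinearMap.toMatrix_apply, add_comm, mul_comm t]
  · simp [M, LinearMap.toMatrix_apply, hij, mul_comm t]

/-- A perturbation of the identity of norm less than one has positive determinant. -/
lemma det_one_add_pos {A : E →L[ℝ] E} (hA : ‖A‖ < 1) : 0 < (1 + A : E →L[ℝ] E).det := by
  have hne : ∀ B ∈ ball (0 : E →L[ℝ] E) 1, (1 + B : E →L[ℝ] E).det ≠ 0 := by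
    intro B hB
    have hB' : ‖-B‖ < 1 := by simpa using hB
    have hu := isUnit_one_sub_of_norm_lt_one hB'
    rw [sub_neg_eq_add] at hu
    exact ((hu.map (ContinuousLinearMap.toLinearMapRingHom (R₁ := ℝ) (M₁ := E))).map
      LinearMap.det).ne_zero
  have hcont : Continuous fun B : E →L[ℝ] E => (1 + B : E →L[ℝ] E).det :=
    ContinuousLinearMap.continuous_det.comp (continuous_const.add continuous_id)
  have hconn : IsPreconnected (ball (0 : E →L[ℝ] E) 1) := (convex_ball _ _).isPreconnected
  by_contra hneg
  have h1 : (0 : ℝ) ∈ Icc ((1 + A : E →L[ℝ] E).det) ((1 + (0 : E →L[ℝ] E)).det) := by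
    refine ⟨not_lt.1 hneg, ?_⟩
    simp [ContinuousLinearMap.det]
  obtain ⟨B, hB, hB0⟩ := hconn.intermediate_value (a := A) (b := 0) (by simpa using hA) (by simp)
    hcont.continuousOn h1
  exact hne B hB hB0

/-- A small perturbation of the identity of a closed ball which fixes the sphere and preserves the
ball is a bijection of the ball. -/
lemma bijOn_closedBall_of_lipschitz {f : E → E} {r : ℝ} {L : ℝ≥0}
    (hf : LipschitzOnWith L f (closedBall 0 r)) (h0 : ∀ x, ‖x‖ = r → f x = 0) (hL : L < 1)
    (hmaps : MapsTo (fun x => x + f x) (closedBall 0 r) (closedBall 0 r)) :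
    BijOn (fun x => x + f x) (closedBall 0 r) (closedBall 0 r) := by
  set F : E → E := fun x => x + (closedBall 0 r).indicator f x with hF
  have happ : ApproximatesLinearOn F ((ContinuousLinearEquiv.refl ℝ E : E ≃L[ℝ] E) : E →L[ℝ] E)
      univ L := by
    intro x _ y _
    have := (hf.indicator_closedBall h0).dist_le_mul x y
    rw [dist_eq_norm, dist_eq_norm] at this
    refine le_of_eq_of_le (congrArg norm ?_) this
    change x + _ - (y + _) - (x - y) = _
    abel
  have hc : Subsingleton E ∨
      L < ‖((ContinuousLinearEquiv.refl ℝ E).symm : E →L[ℝ] E)‖₊⁻¹ := by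
    rcases subsingleton_or_nontrivial E with h | h
    · exact Or.inl h
    · right
      simpa using hL
  have hEq : EqOn F (fun x => x + f x) (closedBall 0 r) := fun x hx => by
    simp only [hF, indicator_of_mem hx]
  refine ⟨hmaps, ?_, ?_⟩
  · exact ((happ.injOn hc).mono (subset_univ _)).congr hEq
  · intro y hy
    obtain ⟨x, rfl⟩ := happ.surjective hc y
    by_cases hx : x ∈ closedBall (0 : E) r
    · exact ⟨x, hx, (hEq hx).symm⟩
    · simp only [hF, indicator_of_notMem hx, add_zero] at hy
      exact absurd hy hx

/-- There is no smooth retraction of a ball onto its boundary sphere. -/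
lemma not_exists_contDiff_retraction [Nontrivial E] {f : E → E} (hf : ContDiff ℝ 1 f) {r : ℝ}
    (hr : 0 < r) (hnorm : ∀ x, ‖f x‖ = r) (hfix : ∀ x, ‖x‖ = r → f x = x) : False := by
  let _ : MeasurableSpace E := borel E
  have : BorelSpace E := ⟨rfl⟩
  set D := closedBall (0 : E) r with hD
  set A : E → E →L[ℝ] E := fun x => fderiv ℝ f x - 1 with hA
  have hAcont : Continuous A := (hf.continuous_fderiv one_ne_zero).sub continuous_const
  have hDc : IsCompact D := isCompact_closedBall _ _
  obtain ⟨C, hC⟩ := hDc.exists_bound_of_continuousOn hAcont.continuousOn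
  have hder : ∀ x, HasFDerivAt (fun x => f x - x) (A x) x := fun x =>
    ((hf.differentiable one_ne_zero) x).hasFDerivAt.sub (hasFDerivAt_id x)
  set L : ℝ≥0 := ⟨max C 0, le_max_right _ _⟩ with hL
  have hLip : LipschitzOnWith L (fun x => f x - x) D :=
    (convex_closedBall _ _).lipschitzOnWith_of_nnnorm_hasFDerivWithin_le
      (fun x _ => (hder x).hasFDerivWithinAt)
      (fun x hx => by
        rw [← NNReal.coe_le_coe]
        exact (hC x hx).trans (le_max_left _ _))
  obtain ⟨δ, hδ0, hδ1, hδL⟩ : ∃ δ : ℝ, 0 < δ ∧ δ ≤ 1 ∧ δ * L < 1 := by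
    refine ⟨1 / (L + 1), by positivity, ?_, ?_⟩
    · rw [div_le_one (by positivity)]; linarith [L.2]
    · rw [div_mul_eq_mul_div, one_mul, div_lt_one (by positivity)]; linarith
  have hcontdet : ∀ t : ℝ, Continuous fun x => (1 + t • A x : E →L[ℝ] E).det := fun t =>
    ContinuousLinearMap.continuous_det.comp (continuous_const.add (hAcont.const_smul t))
  have hint : ∀ t : ℝ, IntegrableOn (fun x => (1 + t • A x : E →L[ℝ] E).det) D := fun t =>
    (hcontdet t).continuousOn.integrableOn_compact hDc
  have hsmall : ∀ t : ℝ, 0 < t → t ≤ δ →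
      ∫ x in D, (1 + t • A x : E →L[ℝ] E).det = volume.real D := by
    intro t ht0 htδ
    have htL : t * L < 1 := lt_of_le_of_lt (mul_le_mul_of_nonneg_right htδ L.2) hδL
    have hbij : BijOn (fun x => x + t • (f x - x)) D D := by
      have hLt : LipschitzOnWith (t.toNNReal * L) (fun x => t • (f x - x)) D := by
        refine LipschitzOnWith.of_dist_le_mul fun x hx y hy => ?_
        rw [dist_smul₀, Real.norm_of_nonneg ht0.le, NNReal.coe_mul, Real.coe_toNNReal t ht0.le,
          mul_assoc]
        exact mul_le_mul_of_nonneg_left (hLip.dist_le_mul x hx y hy) ht0.le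
      refine bijOn_closedBall_of_lipschitz hLt (fun x hx => by simp [hfix x hx]) ?_ ?_
      · rw [← NNReal.coe_lt_coe]; simpa [ht0.le] using htL
      · intro x hx
        have : x + t • (f x - x) = (1 - t) • x + t • f x := by module
        simp only [this]
        exact convex_closedBall (0 : E) r hx (by simp [hnorm]) (by linarith) ht0.le (by ring)
    have hcv := lintegral_abs_det_fderiv_eq_addHaar_image (volume : Measure E)
      (s := D) (f := fun x => x + t • (f x - x)) (f' := fun x => 1 + t • A x)
      measurableSet_closedBall
      (fun x _ => ((hasFDerivAt_id x).add ((hder x).const_smul t)).hasFDerivWithinAt) hbij.injOn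
    rw [hbij.image_eq] at hcv
    have hpos : ∀ x ∈ D, 0 < (1 + t • A x : E →L[ℝ] E).det := by
      intro x hx
      apply det_one_add_pos
      rw [norm_smul, Real.norm_of_nonneg ht0.le]
      exact lt_of_le_of_lt (mul_le_mul_of_nonneg_left ((hC x hx).trans (le_max_left C 0)) ht0.le)
        htL
    rw [integral_eq_lintegral_of_nonneg_ae
      ((ae_restrict_iff' measurableSet_closedBall).2 (.of_forall fun x hx => (hpos x hx).le))
      (hint t).aestronglyMeasurable, measureReal_def, ← hcv]
    congr 1
    refine setLIntegral_congr_fun measurableSet_closedBall fun x hx => ?_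
    simp only [abs_of_pos (hpos x hx)]
  have hone : ∀ x, (1 + (1 : ℝ) • A x : E →L[ℝ] E).det = 0 := by
    intro x
    have h1 : (1 + (1 : ℝ) • A x : E →L[ℝ] E) = fderiv ℝ f x := by simp [hA]
    rw [h1]
    by_contra hdet
    have hfx := ((hf.differentiable one_ne_zero) x).hasFDerivAt
    have h2 := hfx.inner ℝ hfx
    have h3 : (fun y => ⟪f y, f y⟫) = fun _ => r ^ 2 := by
      ext y; rw [real_inner_self_eq_norm_sq, hnorm]
    rw [h3] at h2
    have h4 := h2.unique (hasFDerivAt_const _ _)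
    let e := LinearMap.equivOfDetNeZero (fderiv ℝ f x : E →ₗ[ℝ] E) hdet
    obtain ⟨h, hh⟩ := e.surjective (f x)
    have hh' : fderiv ℝ f x h = f x := hh
    have h5 := congrArg (fun T : E →L[ℝ] ℝ => T h) h4
    simp [hh', hnorm] at h5
    exact hr.ne' h5
  obtain ⟨s, c, hs, hsum⟩ := exists_eval_one_eq_sum_eval (Module.finrank ℝ E) hδ0
  have hvol : ∫ x in D, (1 + (1 : ℝ) • A x : E →L[ℝ] E).det = volume.real D := by
    have hpt : ∀ x, (1 + (1 : ℝ) • A x : E →L[ℝ] E).det =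
        ∑ i ∈ Finset.range (Module.finrank ℝ E + 1), c i * (1 + s i • A x : E →L[ℝ] E).det := by
      intro x
      obtain ⟨P, hP, hPe⟩ := exists_polynomial_eval_eq_det_one_add_smul (A x)
      rw [← hPe, hsum P hP]
      simp only [hPe]
    have hc1 : 1 = ∑ i ∈ Finset.range (Module.finrank ℝ E + 1), c i := by
      simpa using hsum 1 (by simp)
    simp only [hpt]
    rw [integral_finsetSum _ fun i _ => (hint (s i)).const_mul (c i)]
    simp only [integral_const_mul, hsmall _ (hs _).1 (hs _).2]
    rw [← Finset.sum_mul, ← hc1, one_mul]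
  simp only [hone, integral_zero] at hvol
  have : 0 < volume.real D := by
    rw [measureReal_def, ENNReal.toReal_pos_iff]
    exact ⟨measure_closedBall_pos _ _ hr, hDc.measure_lt_top⟩
  linarith

/-- There is no continuous retraction of the unit ball onto the unit sphere. -/
theorem not_exists_continuous_retraction [Nontrivial E] {f : E → E} (hf : Continuous f)
    (hnorm : ∀ x, ‖f x‖ = 1) (hfix : ∀ x, ‖x‖ = 1 → f x = x) : False := by
  classical
  set F : E → E := fun x => if ‖x‖ ≤ 1 then f x else x with hF
  have hFc : Continuous F := by
    refine Continuous.if_le hf continuous_id continuous_norm continuous_const fun x hx => ?_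
    simpa using hfix x hx
  have hF1 : ∀ x, 1 ≤ ‖F x‖ := by
    intro x
    by_cases hx : ‖x‖ ≤ 1
    · simp [hF, hx, hnorm]
    · simp only [hF, hx, if_false]; exact (not_le.1 hx).le
  have hout : EqOn F id {x | 1 < ‖x‖} := fun x hx => by
    simp [hF, not_le.2 (show 1 < ‖x‖ from hx)]
  obtain ⟨g, hg, hgF, hgS, -⟩ := hFc.exists_contDiff_approx_and_eqOn 1 (ε := fun _ => 1 / 2)
    continuous_const (fun _ => by norm_num) (S := {x | 2 ≤ ‖x‖}) (U := {x | 1 < ‖x‖})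
    (isClosed_le continuous_const continuous_norm)
    ((isOpen_lt continuous_const continuous_norm).mem_nhdsSet.2 fun x hx =>
      show 1 < ‖x‖ from lt_of_lt_of_le one_lt_two hx)
    (contDiff_id.contDiffOn.congr hout)
  have hg0 : ∀ x, g x ≠ 0 := by
    intro x hx
    have h1 := hgF x
    rw [hx, dist_zero_left] at h1
    linarith [hF1 x]
  have hgn : ∀ x, ‖g x‖ ≠ 0 := fun x => norm_ne_zero_iff.2 (hg0 x)
  refine not_exists_contDiff_retraction (f := fun x => (2 * ‖g x‖⁻¹) • g x) (r := 2) ?_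
    two_pos ?_ ?_
  · exact (contDiff_const.mul ((hg.norm ℝ hg0).inv hgn)).smul hg
  · intro x
    rw [norm_smul, norm_mul, norm_inv, norm_norm, mul_assoc, inv_mul_cancel₀ (hgn x)]
    norm_num
  · intro x hx
    have : g x = x := by
      rw [hgS (show (2 : ℝ) ≤ ‖x‖ from hx.ge)]
      exact hout (show 1 < ‖x‖ by rw [hx]; norm_num)
    simp [this, hx]

end NoRetraction
section RecessionCone

open Set Metric Filter Topology

variable {n : ℕ} {K : Set (EuclideanSpace ℝ (Fin n))}

lemma zero_mem_recCone (K : Set (EuclideanSpace ℝ (Fin n))) : 0 ∈ recCone K := fun x hx t _ => by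
  simpa using hx

lemma add_mem_recCone {v w : EuclideanSpace ℝ (Fin n)} (hv : v ∈ recCone K)
    (hw : w ∈ recCone K) : v + w ∈ recCone K := fun x hx t ht => by
  simpa [smul_add, add_assoc] using hw _ (hv x hx t ht) t ht

lemma smul_mem_recCone {v : EuclideanSpace ℝ (Fin n)} (hv : v ∈ recCone K) {c : ℝ} (hc : 0 ≤ c) :
    c • v ∈ recCone K := fun x hx t ht => by
  simpa [smul_smul] using hv x hx (t * c) (mul_nonneg ht hc)

lemma convex_recCone (K : Set (EuclideanSpace ℝ (Fin n))) : Convex ℝ (recCone K) :=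
  fun _ hv _ hw _ _ ha hb _ => add_mem_recCone (smul_mem_recCone hv ha) (smul_mem_recCone hw hb)

lemma isClosed_recCone (hK : IsClosed K) : IsClosed (recCone K) := by
  have : recCone K = ⋂ x ∈ K, ⋂ t : ℝ, ⋂ _ : 0 ≤ t, (fun v => x + t • v) ⁻¹' K := by
    ext v; simp [recCone]
  rw [this]
  exact isClosed_biInter fun x _ => isClosed_iInter fun t => isClosed_iInter fun _ =>
    hK.preimage (by fun_prop)

/-- The direction of a half-line in a closed convex set is a recession direction. -/
lemma mem_recCone_of_ray (hKcl : IsClosed K) (hKconv : Convex ℝ K)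
    {x v : EuclideanSpace ℝ (Fin n)} (h : ∀ t : ℝ, 0 ≤ t → x + t • v ∈ K) : v ∈ recCone K := by
  intro y hy t ht
  have hlim : Tendsto (fun k : ℕ => y + (1 / ((k : ℝ) + 1)) • (x - y) + t • v) atTop
      (𝓝 (y + (0 : ℝ) • (x - y) + t • v)) :=
    ((tendsto_one_div_add_atTop_nhds_zero_nat.smul_const _).const_add y).add_const _
  rw [zero_smul, add_zero] at hlim
  refine hKcl.mem_of_tendsto hlim (.of_forall fun k => ?_)
  have hk : (0 : ℝ) < (k : ℝ) + 1 := by positivity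
  have hmem := h (((k : ℝ) + 1) * t) (by positivity)
  have hle : 1 / ((k : ℝ) + 1) ≤ 1 := by
    rw [div_le_one hk]; linarith [(Nat.cast_nonneg k : (0 : ℝ) ≤ k)]
  have := hKconv hy hmem (a := 1 - 1 / ((k : ℝ) + 1)) (b := 1 / ((k : ℝ) + 1))
    (by linarith) (by positivity) (by ring)
  convert this using 1
  rw [smul_add, smul_smul, ← mul_assoc, one_div, inv_mul_cancel₀ hk.ne', one_mul]
  module

/-- An unbounded closed convex set has a nonzero recession direction. -/
lemma exists_ne_zero_mem_recCone (hKcl : IsClosed K) (hKconv : Convex ℝ K)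
    (hKunb : ¬ Bornology.IsBounded K) : ∃ v ∈ recCone K, v ≠ 0 := by
  obtain ⟨x, hx⟩ : K.Nonempty := by
    by_contra h
    rw [not_nonempty_iff_eq_empty] at h
    exact hKunb (h ▸ Bornology.isBounded_empty)
  have hfar : ∀ k : ℕ, ∃ y ∈ K, (k : ℝ) < ‖y - x‖ := by
    intro k
    by_contra! h
    exact hKunb (isBounded_closedBall.subset fun y hy => mem_closedBall_iff_norm.2 (h y hy))
  choose y hyK hyk using hfar
  have hpos : ∀ k, 0 < ‖y k - x‖ := fun k => lt_of_le_of_lt (Nat.cast_nonneg k) (hyk k)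
  let d : ℕ → EuclideanSpace ℝ (Fin n) := fun k => ‖y k - x‖⁻¹ • (y k - x)
  have hd : ∀ k, d k ∈ sphere (0 : EuclideanSpace ℝ (Fin n)) 1 := fun k => by
    rw [mem_sphere_zero_iff_norm]
    simp [d, norm_smul, (hpos k).ne']
  obtain ⟨v, hv, φ, hφ, hlim⟩ := (isCompact_sphere (0 : EuclideanSpace ℝ (Fin n)) 1).tendsto_subseq hd
  refine ⟨v, mem_recCone_of_ray hKcl hKconv (x := x) fun t ht => ?_,
    ne_zero_of_mem_unit_sphere ⟨v, hv⟩⟩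
  have hlim' : Tendsto (fun k => x + t • d (φ k)) atTop (𝓝 (x + t • v)) :=
    (hlim.const_smul t).const_add x
  refine hKcl.mem_of_tendsto hlim' ?_
  obtain ⟨N, hN⟩ := exists_nat_ge t
  filter_upwards [eventually_ge_atTop N] with k hk
  have hle : t ≤ ‖y (φ k) - x‖ := by
    have h1 : (N : ℝ) ≤ (φ k : ℕ) := by exact_mod_cast hk.trans hφ.le_apply
    linarith [hyk (φ k)]
  have := hKconv.add_smul_sub_mem hx (hyK (φ k)) (t := t * ‖y (φ k) - x‖⁻¹)
    ⟨by positivity, by rw [← div_eq_mul_inv]; exact (div_le_one (hpos _)).2 hle⟩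
  simpa [d, smul_smul] using this

/-- The largest linear subspace contained in the recession cone. -/
def recLineality (K : Set (EuclideanSpace ℝ (Fin n))) :
    Submodule ℝ (EuclideanSpace ℝ (Fin n)) where
  carrier := {v | v ∈ recCone K ∧ -v ∈ recCone K}
  zero_mem' := ⟨zero_mem_recCone K, by simpa using zero_mem_recCone K⟩
  add_mem' := fun {v w} hv hw => ⟨add_mem_recCone hv.1 hw.1, by
    rw [neg_add]; exact add_mem_recCone hv.2 hw.2⟩
  smul_mem' := fun c v hv => by
    rcases le_total 0 c with hc | hc
    · exact ⟨smul_mem_recCone hv.1 hc, by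
        rw [← smul_neg]; exact smul_mem_recCone hv.2 hc⟩
    · exact ⟨by simpa using smul_mem_recCone hv.2 (neg_nonneg.2 hc), by
        rw [← neg_smul]; exact smul_mem_recCone hv.1 (neg_nonneg.2 hc)⟩

lemma add_mem_of_mem_recCone {x v : EuclideanSpace ℝ (Fin n)} (hx : x ∈ K) (hv : v ∈ recCone K) :
    x + v ∈ K := by
  simpa using hv x hx 1 zero_le_one

/-- A linear functional that is nonnegative on the recession cone and vanishes there only on the
lineality space attains its minimum. -/
lemma exists_forall_inner_le (hKcl : IsClosed K) (hKconv : Convex ℝ K) (hKne : K.Nonempty)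
    {u : EuclideanSpace ℝ (Fin n)} (hnonneg : ∀ y ∈ recCone K, 0 ≤ ⟪y, u⟫)
    (hpos : ∀ y ∈ recCone K, -y ∉ recCone K → 0 < ⟪y, u⟫) :
    ∃ p ∈ K, ∀ x ∈ K, ⟪p, u⟫ ≤ ⟪x, u⟫ := by
  set L := recLineality K with hL
  have hLu : ∀ y ∈ L, ⟪y, u⟫ = 0 := fun y hy => by
    have h1 := hnonneg y hy.1
    have h2 := hnonneg (-y) hy.2
    rw [inner_neg_left] at h2
    linarith
  have hdec : ∀ x ∈ K, ∃ w ∈ K, w ∈ Lᗮ ∧ ⟪w, u⟫ = ⟪x, u⟫ := by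
    intro x hx
    obtain ⟨l, hl, w, hw, rfl⟩ := L.exists_add_mem_mem_orthogonal x
    refine ⟨w, ?_, hw, by rw [inner_add_left, hLu l hl, zero_add]⟩
    have := add_mem_of_mem_recCone hx hl.2
    simpa [add_comm] using this
  obtain ⟨x₀, hx₀⟩ := hKne
  obtain ⟨w₀, hw₀K, hw₀L, -⟩ := hdec x₀ hx₀
  set S : Set (EuclideanSpace ℝ (Fin n)) := K ∩ (Lᗮ ∩ {x | ⟪x, u⟫ ≤ ⟪w₀, u⟫}) with hS
  have hScl : IsClosed S := hKcl.inter ((Submodule.isClosed_orthogonal L).inter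
    (isClosed_le (by fun_prop) continuous_const))
  have hSconv : Convex ℝ S := hKconv.inter ((Lᗮ).convex.inter
    (convex_halfSpace_le ⟨fun a b => inner_add_left a b u,
      fun c a => by simp [real_inner_smul_left]⟩ _))
  have hw₀S : w₀ ∈ S := ⟨hw₀K, hw₀L, le_refl ⟪w₀, u⟫⟩
  have hSb : Bornology.IsBounded S := by
    by_contra hunb
    obtain ⟨d, hd, hd0⟩ := exists_ne_zero_mem_recCone hScl hSconv hunb
    have hdK : d ∈ recCone K := mem_recCone_of_ray hKcl hKconv fun t ht => (hd w₀ hw₀S t ht).1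
    have hdS := add_mem_of_mem_recCone hw₀S hd
    have hdL : d ∈ Lᗮ := by
      simpa using (Lᗮ).sub_mem hdS.2.1 hw₀L
    have hdu : ⟪d, u⟫ ≤ 0 := by
      have : ⟪w₀ + d, u⟫ ≤ ⟪w₀, u⟫ := hdS.2.2
      rw [inner_add_left] at this
      linarith
    have hdneg : -d ∈ recCone K := by
      by_contra h
      exact absurd (hpos d hdK h) (not_lt.2 hdu)
    have : d ∈ L ⊓ Lᗮ := ⟨⟨hdK, hdneg⟩, hdL⟩
    rw [Submodule.inf_orthogonal_eq_bot] at this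
    exact hd0 ((Submodule.mem_bot ℝ).1 this)
  obtain ⟨p, hpS, hp⟩ := (isCompact_of_isClosed_isBounded hScl hSb).exists_isMinOn ⟨w₀, hw₀S⟩
    (f := fun x => ⟪x, u⟫) (by fun_prop)
  refine ⟨p, hpS.1, fun x hx => ?_⟩
  obtain ⟨w, hwK, hwL, hwx⟩ := hdec x hx
  rw [← hwx]
  by_cases hle : ⟪w, u⟫ ≤ ⟪w₀, u⟫
  · exact hp ⟨hwK, hwL, hle⟩
  · exact (hpS.2.2 : ⟪p, u⟫ ≤ ⟪w₀, u⟫).trans (not_le.1 hle).le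

/-- If the boundary of an unbounded convex body is homeomorphic to a Euclidean space, then its
recession cone is not a linear subspace. -/
lemma exists_mem_recCone_neg_notMem (hKcl : IsClosed K) (hKconv : Convex ℝ K)
    (hKint : (interior K).Nonempty) {k : ℕ}
    (hbd : Nonempty (frontier K ≃ₜ EuclideanSpace ℝ (Fin k))) :
    ∃ y ∈ recCone K, -y ∉ recCone K := by
  by_contra! hsym
  obtain ⟨h⟩ := hbd
  set L := recLineality K with hL
  have hmem : ∀ {v}, v ∈ recCone K → v ∈ L := fun hv => ⟨hv, hsym _ hv⟩
  obtain ⟨p, hp⟩ := hKint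
  -- translation by the lineality space preserves the interior
  have hint : ∀ l ∈ L, p + l ∈ interior K := by
    intro l hl
    have hsub : (fun x => x + -l) ⁻¹' interior K ⊆ K := fun x hx => by
      simpa using add_mem_of_mem_recCone (interior_subset hx) hl.1
    exact interior_maximal hsub (isOpen_interior.preimage (by fun_prop)) (by simpa using hp)
  set P := L.orthogonal.orthogonalProjectionOnto with hP
  have hPne : ∀ x ∈ frontier K, P (x - p) ≠ 0 := by
    intro x hx h0
    have hxl : x - p ∈ L := by
      rw [hP, Submodule.orthogonalProjectionOnto_eq_zero_iff, Submodule.orthogonal_orthogonal] at h0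
      exact h0
    have := hint _ hxl
    rw [add_sub_cancel] at this
    exact hx.2 this
  set s : Set (EuclideanSpace ℝ (Fin n)) := (fun x => p + x) ⁻¹' K with hs
  have hsconv : Convex ℝ s := hKconv.translate_preimage_right p
  have hs0 : s ∈ 𝓝 0 := by
    refine (by fun_prop : Continuous fun x : EuclideanSpace ℝ (Fin n) => p + x).continuousAt
      |>.preimage_mem_nhds ?_
    simpa using mem_interior_iff_mem_nhds.1 hp
  have hscl : IsClosed s :=
    hKcl.preimage (continuous_const.add continuous_id : Continuous fun x => p + x)
  have hfr : ∀ x, x ∈ frontier s → p + x ∈ frontier K := by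
    intro x hx
    have := (Homeomorph.addLeft p).preimage_frontier K
    have h2 : frontier s = (fun x => p + x) ⁻¹' frontier K := this.symm
    rw [h2] at hx
    exact hx
  have hgpos : ∀ w : L.orthogonal, w ≠ 0 → 0 < gauge s (w : EuclideanSpace ℝ (Fin n)) := by
    intro w hw
    refine lt_of_le_of_ne (gauge_nonneg _) fun h0 => hw ?_
    have hray : ∀ t : ℝ, 0 ≤ t → p + t • (w : EuclideanSpace ℝ (Fin n)) ∈ K := by
      intro t ht
      have : gauge s (t • (w : EuclideanSpace ℝ (Fin n))) ≤ 1 := by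
        rw [gauge_smul_of_nonneg ht, ← h0]; simp
      rw [gauge_le_one_iff_mem_closure hsconv hs0, hscl.closure_eq] at this
      exact this
    have hwL : (w : EuclideanSpace ℝ (Fin n)) ∈ L ⊓ Lᗮ :=
      ⟨hmem (mem_recCone_of_ray hKcl hKconv hray), w.2⟩
    rw [Submodule.inf_orthogonal_eq_bot] at hwL
    exact Subtype.ext ((Submodule.mem_bot ℝ).1 hwL)
  have hgc : Continuous (gauge s) := continuous_gauge hsconv hs0
  -- the sphere of `Lᗮ` is a retract of the frontier
  let i : sphere (0 : L.orthogonal) 1 → frontier K := fun θ =>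
    ⟨p + (gauge s ((θ : L.orthogonal) : EuclideanSpace ℝ (Fin n)))⁻¹ •
      ((θ : L.orthogonal) : EuclideanSpace ℝ (Fin n)), hfr _ <| by
        have hθ := hgpos θ (ne_zero_of_mem_unit_sphere θ)
        rw [← gauge_eq_one_iff_mem_frontier hsconv hs0, gauge_smul_of_nonneg (inv_nonneg.2 hθ.le),
          smul_eq_mul, inv_mul_cancel₀ hθ.ne']⟩
  have hic : Continuous i := by
    have hval : Continuous fun θ : sphere (0 : L.orthogonal) 1 =>
        ((θ : L.orthogonal) : EuclideanSpace ℝ (Fin n)) :=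
      continuous_subtype_val.comp continuous_subtype_val
    have hinv := (hgc.comp hval).inv₀ fun θ => (hgpos θ (ne_zero_of_mem_unit_sphere θ)).ne'
    exact Continuous.subtype_mk (continuous_const.add (hinv.smul hval)) _
  let r : frontier K → L.orthogonal := fun x => ‖P (x - p)‖⁻¹ • P (x - p)
  have hrc : Continuous r := by
    have hc : Continuous fun x : frontier K => P (x - p) :=
      P.continuous.comp (continuous_subtype_val.sub continuous_const)
    exact (hc.norm.inv₀ fun x => norm_ne_zero_iff.2 (hPne x x.2)).smul hc
  have hri : ∀ θ, r (i θ) = θ := by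
    intro θ
    have hθ := hgpos θ (ne_zero_of_mem_unit_sphere θ)
    have hθ1 : ‖(θ : L.orthogonal)‖ = 1 := norm_eq_of_mem_sphere θ
    have h1 : P ((i θ : EuclideanSpace ℝ (Fin n)) - p) =
        (gauge s ((θ : L.orthogonal) : EuclideanSpace ℝ (Fin n)))⁻¹ • (θ : L.orthogonal) := by
      simp only [i, add_sub_cancel_left, map_smul]
      rw [hP, Submodule.orthogonalProjectionOnto_mem_subspace_eq_self]
    simp only [r, h1]
    rw [norm_smul, hθ1, mul_one, norm_inv, Real.norm_of_nonneg hθ.le, inv_inv, smul_smul,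
      mul_inv_cancel₀ hθ.ne', one_smul]
  have hrn : ∀ x, ‖r x‖ = 1 := fun x => by
    simp only [r]
    rw [norm_smul, norm_inv, norm_norm, inv_mul_cancel₀ (norm_ne_zero_iff.2 (hPne x x.2))]
  have : Nontrivial L.orthogonal := by
    have x := h.symm 0
    exact ⟨P (x - p), 0, hPne x x.2⟩
  obtain ⟨g, hg⟩ := ContinuousMap.exists_restrict_eq
    (isClosed_sphere (x := (0 : L.orthogonal)) (ε := 1)) ⟨fun θ => h (i θ), h.continuous.comp hic⟩
  refine not_exists_continuous_retraction (f := fun x => r (h.symm (g x)))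
    (hrc.comp (h.symm.continuous.comp g.continuous)) (fun x => hrn _) fun x hx => ?_
  have hx' : x ∈ sphere (0 : L.orthogonal) 1 := by simpa using hx
  have : g x = h (i ⟨x, hx'⟩) := congrArg (fun q => q ⟨x, hx'⟩) hg
  simp only [this, h.symm_apply_apply, hri]

end RecessionCone

section SphericalMeasure

open Set Metric Filter Topology Module

variable {E : Type*} [NormedAddCommGroup E] [InnerProductSpace ℝ E]

lemma norm_inv_norm_smul_sub_le {x y : E} (hx : 1 ≤ ‖x‖) (hy : 1 ≤ ‖y‖) :
    ‖‖x‖⁻¹ • x - ‖y‖⁻¹ • y‖ ≤ 2 * ‖x - y‖ := by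
  have hx0 : 0 < ‖x‖ := by linarith
  have hy0 : 0 < ‖y‖ := by linarith
  have h1 : ‖x‖⁻¹ • x - ‖y‖⁻¹ • y = ‖x‖⁻¹ • ((x - y) + (‖y‖ - ‖x‖) • (‖y‖⁻¹ • y)) := by
    simp only [smul_add, smul_sub, smul_smul, ← mul_assoc]
    have : ‖x‖⁻¹ * (‖y‖ - ‖x‖) * ‖y‖⁻¹ = ‖x‖⁻¹ - ‖y‖⁻¹ := by field_simp
    rw [this, sub_smul]
    abel
  have h2 : ‖‖y‖⁻¹ • y‖ = 1 := by
    rw [norm_smul, norm_inv, norm_norm, inv_mul_cancel₀ hy0.ne']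
  have h3 : ‖(x - y) + (‖y‖ - ‖x‖) • (‖y‖⁻¹ • y)‖ ≤ 2 * ‖x - y‖ := by
    refine (norm_add_le _ _).trans ?_
    rw [norm_smul, h2, mul_one, Real.norm_eq_abs]
    have := abs_norm_sub_norm_le y x
    rw [norm_sub_rev y x] at this
    linarith
  rw [h1, norm_smul, norm_inv, norm_norm]
  calc ‖x‖⁻¹ * _ ≤ 1 * _ := by
        gcongr
        exact inv_le_one_of_one_le₀ hx
    _ ≤ _ := by rw [one_mul]; exact h3

lemma reflection_orthogonal_singleton_eq {y : E} (hy : ‖y‖ = 1) (x : E) :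
    (ℝ ∙ y)ᗮ.reflection x = x + (-(2 * ⟪x, y⟫)) • y := by
  rw [Submodule.reflection_orthogonal_apply, Submodule.reflection_singleton_apply, hy,
    real_inner_comm x y]
  simp only [RCLike.ofReal_real_eq_id, id, one_pow, div_one, neg_sub, neg_smul, mul_smul, two_smul]
  abel

variable [FiniteDimensional ℝ E]

lemma finrank_orthogonal_singleton_inf {V : Submodule ℝ E} {a : E} (haV : a ∈ V) (ha : a ≠ 0) :
    (finrank ℝ V : ℝ) - 1 = (finrank ℝ ((ℝ ∙ a)ᗮ ⊓ V : Submodule ℝ E) : ℝ) := by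
  have h := Submodule.finrank_add_inf_finrank_orthogonal
    ((Submodule.span_singleton_le_iff_mem a V).2 haV)
  rw [finrank_span_singleton ha] at h
  rw [← h]
  push_cast
  ring

lemma Convex.interior_preimage_span_nonempty {C : Set E} (hconv : Convex ℝ C) (h0 : 0 ∈ C) :
    (interior (((↑) : Submodule.span ℝ C → E) ⁻¹' C)).Nonempty := by
  have hc : Convex ℝ (((↑) : Submodule.span ℝ C → E) ⁻¹' C) :=
    hconv.linear_preimage (Submodule.span ℝ C).subtype
  rw [hc.interior_nonempty_iff_affineSpan_eq_top]
  have h0' : (0 : Submodule.span ℝ C) ∈ ((↑) : Submodule.span ℝ C → E) ⁻¹' C := by simpa using h0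
  rw [← insert_eq_of_mem h0']
  apply SetLike.coe_injective
  rw [affineSpan_insert_zero, Submodule.span_span_coe_preimage]
  rfl

variable [MeasurableSpace E] [BorelSpace E]

lemma hausdorffMeasure_inter_sphere_lt_top (V : Submodule ℝ E) :
    (μH[(finrank ℝ V : ℝ) - 1] : Measure E) ((V : Set E) ∩ sphere 0 1) < ⊤ := by
  have hcpt : IsCompact ((V : Set E) ∩ sphere 0 1) :=
    (isCompact_sphere 0 1).inter_left V.closed_of_finiteDimensional
  refine hcpt.measure_lt_top_of_nhdsWithin fun a ha => ?_
  have ha1 : ‖a‖ = 1 := by simpa using ha.2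
  have ha0 : a ≠ 0 := by rintro rfl; simp at ha1
  refine ⟨{x | 1 / 2 < ⟪x, a⟫} ∩ ((V : Set E) ∩ sphere 0 1), ?_, ?_⟩
  · refine inter_mem (mem_nhdsWithin_of_mem_nhds ?_) self_mem_nhdsWithin
    refine (isOpen_lt continuous_const (by fun_prop)).mem_nhds ?_
    simp only [mem_ofPred_eq, real_inner_self_eq_norm_sq, ha1]
    norm_num
  rw [finrank_orthogonal_singleton_inf ha.1 ha0]
  set T : Submodule ℝ E := (ℝ ∙ a)ᗮ ⊓ V
  have hTa : ∀ w : T, ⟪(w : E), a⟫ = 0 := fun w =>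
    (Submodule.mem_orthogonal_singleton_iff_inner_left.1 w.2.1)
  have hnorm : ∀ w : T, 1 ≤ ‖a + w‖ := by
    intro w
    have h : ⟪a + w, a⟫ = 1 := by
      rw [inner_add_left, hTa, real_inner_self_eq_norm_sq, ha1]; norm_num
    have := real_inner_le_norm (a + w) a
    rwa [h, ha1, mul_one] at this
  let φ : T → E := fun w => ‖a + w‖⁻¹ • (a + w)
  have hφ : LipschitzWith 2 φ := LipschitzWith.of_dist_le_mul fun x y => by
    rw [dist_eq_norm, dist_eq_norm]
    have h := norm_inv_norm_smul_sub_le (hnorm x) (hnorm y)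
    rwa [add_sub_add_left_eq_sub] at h
  have hsub : {x | 1 / 2 < ⟪x, a⟫} ∩ ((V : Set E) ∩ sphere 0 1) ⊆ φ '' closedBall 0 3 := by
    rintro x ⟨hxa, hxV, hx1⟩
    have hxa : 1 / 2 < ⟪x, a⟫ := hxa
    have hx1 : ‖x‖ = 1 := by simpa using hx1
    have hc : 0 < ⟪x, a⟫ := by linarith
    have hw : ⟪x, a⟫⁻¹ • x - a ∈ T := by
      refine ⟨Submodule.mem_orthogonal_singleton_iff_inner_left.2 ?_,
        V.sub_mem (V.smul_mem _ hxV) ha.1⟩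
      rw [inner_sub_left, real_inner_smul_left, real_inner_self_eq_norm_sq, ha1,
        inv_mul_cancel₀ hc.ne']
      norm_num
    refine ⟨⟨_, hw⟩, ?_, ?_⟩
    · rw [mem_closedBall_zero_iff]
      refine (norm_sub_le _ _).trans ?_
      rw [norm_smul, norm_inv, Real.norm_of_nonneg hc.le, hx1, ha1, mul_one]
      have : ⟪x, a⟫⁻¹ ≤ 2 := by
        rw [inv_le_comm₀ hc two_pos]; linarith
      linarith
    · simp only [φ, add_sub_cancel]
      rw [norm_smul, norm_inv, Real.norm_of_nonneg hc.le, hx1, mul_one, inv_inv, smul_smul,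
        mul_inv_cancel₀ hc.ne', one_smul]
  refine (measure_mono hsub).trans_lt ?_
  refine (hφ.hausdorffMeasure_image_le (Nat.cast_nonneg _) _).trans_lt ?_
  refine ENNReal.mul_lt_top (ENNReal.rpow_lt_top_of_nonneg (Nat.cast_nonneg _) (by simp)) ?_
  exact (isCompact_closedBall _ _).measure_lt_top

lemma hausdorffMeasure_cone_inter_sphere_inter_pos {C : Set E} (hconv : Convex ℝ C) (h0 : 0 ∈ C)
    (hsmul : ∀ x ∈ C, ∀ c : ℝ, 0 ≤ c → c • x ∈ C) {O : Set E} (hO : IsOpen O)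
    (hne : (C ∩ sphere 0 1 ∩ O).Nonempty) :
    0 < (μH[(finrank ℝ (Submodule.span ℝ C) : ℝ) - 1] : Measure E) (C ∩ sphere 0 1 ∩ O) := by
  obtain ⟨x₀, ⟨hx₀C, hx₀1⟩, hx₀O⟩ := hne
  have hx₀1 : ‖x₀‖ = 1 := by simpa using hx₀1
  set V := Submodule.span ℝ C
  set C' : Set V := ((↑) : V → E) ⁻¹' C
  have hC' : Convex ℝ C' := hconv.linear_preimage V.subtype
  have hint : (interior C').Nonempty := hconv.interior_preimage_span_nonempty h0
  set U : Set V := {w | w ≠ 0} ∩ {w | ‖w‖⁻¹ • (w : E) ∈ O}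
  have hU : IsOpen U := by
    have hc : ContinuousOn (fun w : V => ‖w‖⁻¹ • (w : E)) {w | w ≠ 0} :=
      (continuous_norm.continuousOn.inv₀ fun w hw => norm_ne_zero_iff.2 hw).smul
        continuous_subtype_val.continuousOn
    exact hc.isOpen_inter_preimage isOpen_ne hO
  let x' : V := ⟨x₀, Submodule.subset_span hx₀C⟩
  have hx'U : x' ∈ U := by
    refine ⟨fun h => ?_, ?_⟩
    · have : x₀ = 0 := congrArg Subtype.val h
      simp [this] at hx₀1
    · have : ‖x'‖ = 1 := hx₀1
      change ‖x'‖⁻¹ • x₀ ∈ O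
      rwa [this, inv_one, one_smul]
  have hx'C : x' ∈ closure (interior C') := by
    rw [hC'.closure_interior_eq_closure_of_nonempty_interior hint]
    exact subset_closure hx₀C
  obtain ⟨b, ⟨hb0, hbO⟩, hbC⟩ := mem_closure_iff.1 hx'C U hU hx'U
  have hbn : 0 < ‖b‖ := norm_pos_iff.2 hb0
  set a : V := ‖b‖⁻¹ • b
  have ha1 : ‖a‖ = 1 := by
    rw [norm_smul, norm_inv, norm_norm, inv_mul_cancel₀ hbn.ne']
  have haE : ‖(a : E)‖ = 1 := ha1
  have ha0 : (a : E) ≠ 0 := by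
    intro h; simp [h] at haE
  have haW : C' ∩ {w : V | (w : E) ∈ O} ∈ 𝓝 a := by
    refine inter_mem ?_ ((hO.preimage continuous_subtype_val).mem_nhds hbO)
    have h1 : (fun w : V => ‖b‖ • w) ⁻¹' C' ∈ 𝓝 a := by
      refine (continuous_const_smul ‖b‖).continuousAt.preimage_mem_nhds ?_
      simpa only [a, smul_smul, mul_inv_cancel₀ hbn.ne', one_smul] using
        mem_interior_iff_mem_nhds.1 hbC
    filter_upwards [h1] with w hw
    have := hsmul _ hw ‖b‖⁻¹ (by positivity)
    change (w : E) ∈ C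
    simpa only [Submodule.coe_smul, smul_smul, inv_mul_cancel₀ hbn.ne', one_smul] using this
  rw [finrank_orthogonal_singleton_inf a.2 ha0]
  set T : Submodule ℝ E := (ℝ ∙ (a : E))ᗮ ⊓ V
  have hTa : ∀ w : T, ⟪(w : E), (a : E)⟫ = 0 := fun w =>
    (Submodule.mem_orthogonal_singleton_iff_inner_left.1 w.2.1)
  let f : T → V := fun w => ⟨w, w.2.2⟩ + √(1 - ‖w‖ ^ 2) • a
  have hf : Continuous f := by
    have hc : Continuous fun w : T => √(1 - ‖w‖ ^ 2) := by fun_prop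
    exact (Continuous.subtype_mk continuous_subtype_val _).add (hc.smul continuous_const)
  have hf0 : f 0 = a := by
    apply Subtype.ext
    simp [f]
  obtain ⟨ε, hε, hball⟩ := Metric.mem_nhds_iff.1 (hf.continuousAt.preimage_mem_nhds (hf0 ▸ haW))
  have hsub : ball (0 : T) (min ε 1) ⊆ T.orthogonalProjectionOnto '' (C ∩ sphere 0 1 ∩ O) := by
    intro w hw
    have hw' := hball (ball_subset_ball (min_le_left _ _) hw)
    have hw1 : ‖w‖ < 1 := by
      have := ball_subset_ball (min_le_right _ _) hw
      simpa using this
    have hpos : 0 ≤ 1 - ‖w‖ ^ 2 := by nlinarith [norm_nonneg w]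
    have hfw : ((f w : V) : E) = w + √(1 - ‖w‖ ^ 2) • (a : E) := rfl
    refine ⟨f w, ⟨⟨hw'.1, ?_⟩, hw'.2⟩, ?_⟩
    · rw [mem_sphere_zero_iff_norm, ← sq_eq_sq₀ (norm_nonneg _) zero_le_one, hfw,
        norm_add_sq_real, real_inner_smul_right, hTa, norm_smul, haE, mul_one,
        Real.norm_of_nonneg (Real.sqrt_nonneg _), Real.sq_sqrt hpos]
      simp
    · have h1 : T.orthogonalProjectionOnto (a : E) = 0 := by
        rw [Submodule.orthogonalProjectionOnto_eq_zero_iff]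
        exact (Submodule.mem_orthogonal _ _).2 fun w hw => hTa ⟨w, hw⟩
      rw [hfw, map_add, map_smul, h1, smul_zero, add_zero,
        Submodule.orthogonalProjectionOnto_mem_subspace_eq_self]
  calc 0 < (μH[(finrank ℝ T : ℝ)] : Measure T) (ball 0 (min ε 1)) :=
        measure_ball_pos _ _ (lt_min hε one_pos)
    _ ≤ _ := measure_mono hsub
    _ ≤ _ := hausdorffMeasure_orthogonalProjectionOnto_le _ _ _ (Nat.cast_nonneg _)

lemma integrableOn_id_cone_inter_sphere {C : Set E} (hcl : IsClosed C) :
    IntegrableOn (fun x : E => x) (C ∩ sphere 0 1)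
      (μH[(finrank ℝ (Submodule.span ℝ C) : ℝ) - 1]) := by
  have hs : MeasurableSet (C ∩ sphere (0 : E) 1) := (hcl.inter isClosed_sphere).measurableSet
  refine Measure.integrableOn_of_bounded (M := 1) ?_ (by fun_prop) ?_
  · exact ((measure_mono (inter_subset_inter_left _ Submodule.subset_span)).trans_lt
      (hausdorffMeasure_inter_sphere_lt_top _)).ne
  · filter_upwards [ae_restrict_mem hs] with x hx
    exact (mem_sphere_zero_iff_norm.1 hx.2).le

/-- Reflecting in the hyperplane orthogonal to `y` shows that the spherical integral of a closed
convex cone pairs nonnegatively with every element `y` of the cone. -/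
lemma inner_setIntegral_cone_inter_sphere {C : Set E} (hcl : IsClosed C) (hconv : Convex ℝ C)
    (h0 : 0 ∈ C) (hadd : ∀ x ∈ C, ∀ y ∈ C, x + y ∈ C)
    (hsmul : ∀ x ∈ C, ∀ c : ℝ, 0 ≤ c → c • x ∈ C) {y : E} (hyC : y ∈ C) (hy : ‖y‖ = 1) :
    0 ≤ ⟪y, ∫ x in C ∩ sphere 0 1, x ∂(μH[(finrank ℝ (Submodule.span ℝ C) : ℝ) - 1])⟫ ∧
    (-y ∉ C →
      0 < ⟪y, ∫ x in C ∩ sphere 0 1, x ∂(μH[(finrank ℝ (Submodule.span ℝ C) : ℝ) - 1])⟫) := by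
  have hint := integrableOn_id_cone_inter_sphere hcl
  rw [← integral_inner hint]
  set s : Set E := C ∩ sphere 0 1
  set μ : Measure E := μH[(finrank ℝ (Submodule.span ℝ C) : ℝ) - 1]
  set σ : E ≃ₗᵢ[ℝ] E := (ℝ ∙ y)ᗮ.reflection
  have hσ : ∀ x, σ x = x + (-(2 * ⟪x, y⟫)) • y := reflection_orthogonal_singleton_eq hy
  have hσσ : ∀ x, σ (σ x) = x := Submodule.reflection_reflection _
  have hgσ : ∀ x, ⟪y, σ x⟫ = -⟪y, x⟫ := fun x => by
    rw [hσ, inner_add_right, real_inner_smul_right, real_inner_self_eq_norm_sq, hy,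
      real_inner_comm x y]
    ring
  have hs : MeasurableSet s := (hcl.inter isClosed_sphere).measurableSet
  have hσs : MeasurableSet (σ ⁻¹' s) := σ.continuous.measurable hs
  have hg : IntegrableOn (fun x => ⟪y, x⟫) s μ := hint.const_inner y
  have hB : ∫ x in s ∩ σ ⁻¹' s, ⟪y, x⟫ ∂μ = 0 := by
    have hpre : σ ⁻¹' (s ∩ σ ⁻¹' s) = s ∩ σ ⁻¹' s := by
      ext x
      simp only [mem_preimage, mem_inter_iff, hσσ]
      exact and_comm
    have h := (σ.toIsometryEquiv.measurePreserving_hausdorffMeasure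
      ((finrank ℝ (Submodule.span ℝ C) : ℝ) - 1)).setIntegral_preimage_emb
        σ.toHomeomorph.measurableEmbedding (fun x => ⟪y, x⟫) (s ∩ σ ⁻¹' s)
    change ∫ x in σ ⁻¹' (s ∩ σ ⁻¹' s), ⟪y, σ x⟫ ∂μ = ∫ x in s ∩ σ ⁻¹' s, ⟪y, x⟫ ∂μ at h
    rw [hpre] at h
    simp only [hgσ, integral_neg] at h
    linarith
  have hpos : ∀ x ∈ s \ σ ⁻¹' s, 0 < ⟪y, x⟫ := by
    rintro x ⟨hxs, hx⟩
    by_contra! hle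
    refine hx ⟨?_, ?_⟩
    · rw [hσ, real_inner_comm]
      exact hadd _ hxs.1 _ (hsmul _ hyC _ (by linarith))
    · rw [mem_sphere_zero_iff_norm, σ.norm_map]
      exact mem_sphere_zero_iff_norm.1 hxs.2
  have hnonneg : 0 ≤ᵐ[μ.restrict (s \ σ ⁻¹' s)] fun x => ⟪y, x⟫ := by
    filter_upwards [ae_restrict_mem (hs.diff hσs)] with x hx using (hpos x hx).le
  rw [← integral_inter_add_sdiff hσs hg, hB, zero_add]
  refine ⟨integral_nonneg_of_ae hnonneg, fun hyn => ?_⟩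
  rw [setIntegral_pos_iff_support_of_nonneg_ae hnonneg (hg.mono_set sdiff_subset),
    inter_eq_right.2 fun x hx => Function.mem_support.2 (hpos x hx).ne']
  have hD : s \ σ ⁻¹' s = C ∩ sphere 0 1 ∩ σ ⁻¹' Cᶜ := by
    ext x
    simp only [s, Set.mem_sdiff, mem_inter_iff, mem_preimage, mem_compl_iff,
      mem_sphere_zero_iff_norm, σ.norm_map]
    tauto
  rw [hD]
  refine hausdorffMeasure_cone_inter_sphere_inter_pos hconv h0 hsmul
    (hcl.isOpen_compl.preimage σ.continuous) ⟨y, ⟨hyC, by simpa using hy⟩, ?_⟩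
  have hσy : σ y = -y := Submodule.reflection_orthogonalComplement_singleton_eq_neg y
  simpa [hσy] using hyn

lemma setIntegral_cone_inter_sphere_mem {C : Set E} (hcl : IsClosed C) (hconv : Convex ℝ C)
    (h0 : 0 ∈ C) (hsmul : ∀ x ∈ C, ∀ c : ℝ, 0 ≤ c → c • x ∈ C) :
    ∫ x in C ∩ sphere 0 1, x ∂(μH[(finrank ℝ (Submodule.span ℝ C) : ℝ) - 1]) ∈ C := by
  set μ : Measure E := μH[(finrank ℝ (Submodule.span ℝ C) : ℝ) - 1]
  have hs : MeasurableSet (C ∩ sphere (0 : E) 1) := (hcl.inter isClosed_sphere).measurableSet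
  by_cases hμ : μ (C ∩ sphere 0 1) = 0
  · rwa [Measure.restrict_eq_zero.2 hμ, integral_zero_measure]
  have htop : μ (C ∩ sphere 0 1) ≠ ⊤ :=
    ((measure_mono (inter_subset_inter_left _ Submodule.subset_span)).trans_lt
      (hausdorffMeasure_inter_sphere_lt_top _)).ne
  have havg : ⨍ x in C ∩ sphere 0 1, x ∂μ ∈ C :=
    hconv.set_average_mem hcl hμ htop
      (by filter_upwards [ae_restrict_mem hs] with x hx using hx.1)
      (integrableOn_id_cone_inter_sphere hcl)
  rw [← measure_smul_setAverage _ htop]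
  exact hsmul _ havg _ measureReal_nonneg

end SphericalMeasure

/-- For an unbounded convex body `K ⊆ ℝⁿ` whose boundary is homeomorphic to `ℝⁿ⁻¹`, the vector
`v = ∫_{rec(K) ∩ S^{n-1}} x dμH^{m-1}` is nonzero, and the central direction `u = v/‖v‖` is a
balanced direction of `K`: `u ∈ rec(K)`, `K` has a support hyperplane with outward normal `-u`,
and the corresponding face contains a half-line only when it contains the whole line. -/
theorem central_direction_well_defined_and_balanced (n : ℕ) (hn : 1 ≤ n)
    (K : Set (EuclideanSpace ℝ (Fin n)))
    (hKcl : IsClosed K) (hKconv : Convex ℝ K) (hKint : (interior K).Nonempty)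
    (hKunb : ¬ Bornology.IsBounded K)
    (hbd : Nonempty ((frontier K) ≃ₜ EuclideanSpace ℝ (Fin (n - 1))))
    (v : EuclideanSpace ℝ (Fin n))
    (hv : v = ∫ x in recCone K ∩ Metric.sphere (0 : EuclideanSpace ℝ (Fin n)) 1, x
      ∂(μH[(Module.finrank ℝ (Submodule.span ℝ (recCone K)) : ℝ) - 1])) :
    v ≠ 0 ∧
      (‖v‖⁻¹ • v ∈ recCone K ∧
        ∃ p ∈ K, (∀ x ∈ K, ⟪p, ‖v‖⁻¹ • v⟫ ≤ ⟪x, ‖v‖⁻¹ • v⟫) ∧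
          ∀ x ∈ {z ∈ K | ⟪z, ‖v‖⁻¹ • v⟫ = ⟪p, ‖v‖⁻¹ • v⟫},
            ∀ v₀ : EuclideanSpace ℝ (Fin n), v₀ ≠ 0 →
              (∀ t : ℝ, 0 ≤ t → x + t • v₀ ∈ {z ∈ K | ⟪z, ‖v‖⁻¹ • v⟫ = ⟪p, ‖v‖⁻¹ • v⟫}) →
              ∀ t : ℝ, x + t • v₀ ∈ {z ∈ K | ⟪z, ‖v‖⁻¹ • v⟫ = ⟪p, ‖v‖⁻¹ • v⟫}) := by
  have hKne : K.Nonempty := hKint.mono interior_subset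
  have hcl := isClosed_recCone hKcl
  have hsmul : ∀ x ∈ recCone K, ∀ c : ℝ, 0 ≤ c → c • x ∈ recCone K :=
    fun x hx c hc => smul_mem_recCone hx hc
  have hvC : v ∈ recCone K := by
    rw [hv]
    exact setIntegral_cone_inter_sphere_mem hcl (convex_recCone K) (zero_mem_recCone K) hsmul
  have hinner : ∀ y ∈ recCone K, 0 ≤ ⟪y, v⟫ ∧ (-y ∉ recCone K → 0 < ⟪y, v⟫) := by
    intro y hy
    rcases eq_or_ne y 0 with rfl | hy0
    · exact ⟨by simp, fun h => absurd (zero_mem_recCone K) (by simpa using h)⟩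
    have hyn : 0 < ‖y‖ := norm_pos_iff.2 hy0
    have h := inner_setIntegral_cone_inter_sphere hcl (convex_recCone K) (zero_mem_recCone K)
      (fun x hx z hz => add_mem_recCone hx hz) hsmul
      (smul_mem_recCone hy (inv_nonneg.2 hyn.le)) (norm_smul_inv_norm (𝕜 := ℝ) hy0)
    rw [← hv, real_inner_smul_left, mul_nonneg_iff_of_pos_left (inv_pos.2 hyn),
      mul_pos_iff_of_pos_left (inv_pos.2 hyn)] at h
    refine ⟨h.1, fun hny => h.2 fun hc => hny ?_⟩
    simpa only [smul_neg, smul_smul, mul_inv_cancel₀ hyn.ne', one_smul] using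
      smul_mem_recCone hc hyn.le
  have hv0 : v ≠ 0 := by
    rintro rfl
    obtain ⟨y, hy, hny⟩ := exists_mem_recCone_neg_notMem hKcl hKconv hKint hbd
    simpa using (hinner y hy).2 hny
  have hvn : 0 < ‖v‖⁻¹ := inv_pos.2 (norm_pos_iff.2 hv0)
  set u := ‖v‖⁻¹ • v
  have hnonneg : ∀ y ∈ recCone K, 0 ≤ ⟪y, u⟫ := fun y hy => by
    rw [real_inner_smul_right]
    exact mul_nonneg hvn.le (hinner y hy).1
  have hpos : ∀ y ∈ recCone K, -y ∉ recCone K → 0 < ⟪y, u⟫ := fun y hy hny => by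
    rw [real_inner_smul_right]
    exact mul_pos hvn ((hinner y hy).2 hny)
  obtain ⟨p, hpK, hp⟩ := exists_forall_inner_le hKcl hKconv hKne hnonneg hpos
  refine ⟨hv0, smul_mem_recCone hvC hvn.le, p, hpK, hp, fun x hx v₀ _ hray t => ?_⟩
  have hv₀ : v₀ ∈ recCone K := mem_recCone_of_ray hKcl hKconv fun t ht => (hray t ht).1
  have hv₀u : ⟪v₀, u⟫ = 0 := by
    have h := (hray 1 zero_le_one).2
    rw [one_smul, inner_add_left, hx.2] at h
    linarith
  have hneg : -v₀ ∈ recCone K := by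
    by_contra hny
    exact (hpos v₀ hv₀ hny).ne' hv₀u
  refine ⟨?_, ?_⟩
  · rcases le_total 0 t with ht | ht
    · exact hv₀ x hx.1 t ht
    · simpa using hneg x hx.1 (-t) (neg_nonneg.2 ht)
  · rw [inner_add_left, real_inner_smul_left, hv₀u, mul_zero, add_zero]
    exact hx.2
end
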